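/- arXiv:2412.09493 — 2 statements merged into one kernel-verified Lean document; each statement's English description precedes it below -/
import Mathlib

section
/- Let u ∈ L^∞(Ω×(0,T); ℝ^d) with div_x u_t = 0 in the sense of distributions for almost every t, and let ρ ∈ L¹(Ω×(0,T)) with distributional spatial gradient ∇ρ a finite ℝ^d-valued Borel measure on Ω×(0,T), with Radon–Nikodym decomposition ∇ρ = ∇^a ρ + ∇^s ρ with respect to (d+1)-dimensional Lebesgue measure. Then div_x(ρu) is a finite Borel measure on Ω×(0,T) and div_x(ρu) = u · ∇^a ρ + μ with μ singular with respect to Lebesgue measure and |μ| ≤ ‖u‖_{L^∞} |∇^s ρ| as measures. -/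
open MeasureTheory Metric Set Filter Topology
open scoped RealInnerProductSpace

/-- A linear functional on square integrable functions that is bounded by `C` times the
`L¹(σ)` seminorm is integration against a density bounded by `C`. -/
theorem exists_density_of_abs_le_integral_abs {α : Type*} [MeasurableSpace α] (σ : Measure α)
    [IsFiniteMeasure σ] {C : ℝ} (hC : 0 ≤ C) (S : Submodule ℝ (α → ℝ))
    (hS : ∀ f ∈ S, MemLp f 2 σ) (L : S →ₗ[ℝ] ℝ)
    (hL : ∀ f : S, |L f| ≤ C * ∫ a, |(f : α → ℝ) a| ∂σ) :
    ∃ k : α → ℝ, Measurable k ∧ (∀ᵐ a ∂σ, |k a| ≤ C) ∧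
      ∀ f : S, L f = ∫ a, (f : α → ℝ) a * k a ∂σ := by
  let T : S →ₗ[ℝ] Lp ℝ 2 σ :=
    { toFun := fun f => (hS f f.2).toLp f
      map_add' := fun f g => MemLp.toLp_add (hS f f.2) (hS g g.2)
      map_smul' := fun c f => MemLp.toLp_const_smul c (hS f f.2) }
  have hT : ∀ f : S, (T f : α → ℝ) =ᵐ[σ] f := fun f => (hS f f.2).coeFn_toLp
  have hTint : ∀ f : S, ∫ a, |(T f : α → ℝ) a| ∂σ = ∫ a, |(f : α → ℝ) a| ∂σ := fun f =>
    integral_congr_ae ((hT f).mono fun a ha => by simp only [ha])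
  obtain ⟨G₀, hG₀⟩ : ∃ G₀ : Module.Dual ℝ (Lp ℝ 2 σ), T.dualMap G₀ = L := by
    have : L ∈ LinearMap.range T.dualMap := by
      rw [LinearMap.range_dualMap_eq_dualAnnihilator_ker, Submodule.mem_dualAnnihilator]
      intro f hf
      have h0 : ∫ a, |(f : α → ℝ) a| ∂σ = 0 := by
        rw [← hTint f, LinearMap.mem_ker.1 hf, ← integral_zero α ℝ (μ := σ)]
        refine integral_congr_ae ((Lp.coeFn_zero ℝ 2 σ).mono fun a ha => ?_)
        simp only [ha, Pi.zero_apply, abs_zero]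
      have := hL f
      rw [h0, mul_zero] at this
      exact abs_nonpos_iff.1 this
    exact this
  have hint : ∀ x : Lp ℝ 2 σ, Integrable (x : α → ℝ) σ := fun x =>
    (Lp.memLp x).integrable (by norm_num)
  obtain ⟨G, hG, hGle⟩ := exists_extension_of_le_sublinear
    ⟨LinearMap.range T, G₀.domRestrict (LinearMap.range T)⟩
    (fun x : Lp ℝ 2 σ => C * ∫ a, |(x : α → ℝ) a| ∂σ)
    (by
      intro c hc x
      have : ∫ a, |((c • x : Lp ℝ 2 σ) : α → ℝ) a| ∂σ = ∫ a, c * |(x : α → ℝ) a| ∂σ :=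
        integral_congr_ae ((Lp.coeFn_smul c x).mono fun a ha => by
          simp [ha, abs_mul, abs_of_pos hc])
      simp only [this, integral_const_mul]
      ring)
    (by
      intro x y
      rw [← mul_add, ← integral_add (hint x).abs (hint y).abs]
      refine mul_le_mul_of_nonneg_left ?_ hC
      refine integral_mono_ae (hint _).abs ((hint x).abs.add (hint y).abs)
        ((Lp.coeFn_add x y).mono fun a ha => ?_)
      simp only [ha, Pi.add_apply]
      exact abs_add_le _ _)
    (by
      rintro ⟨_, f, rfl⟩
      have : G₀ (T f) = L f := by rw [← hG₀]; rfl
      calc G₀ (T f) ≤ |L f| := this ▸ le_abs_self _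
        _ ≤ _ := hL f
        _ = _ := by rw [← hTint f])
  have hGabs : ∀ x, |G x| ≤ C * ∫ a, |(x : α → ℝ) a| ∂σ := fun x => by
    refine abs_le'.2 ⟨hGle x, ?_⟩
    rw [← map_neg]
    refine (hGle (-x)).trans_eq ?_
    congr 1
    refine integral_congr_ae ((Lp.coeFn_neg x).mono fun a ha => ?_)
    simp only [ha, Pi.neg_apply, abs_neg]
  have hGT : ∀ f : S, G (T f) = L f := fun f => by
    rw [hG ⟨T f, f, rfl⟩, ← hG₀]; rfl
  have hbound : ∀ x : Lp ℝ 2 σ, ‖G x‖ ≤ (C * (σ.real univ) ^ (1 / 2 : ℝ)) * ‖x‖ := fun x => by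
    refine (hGabs x).trans ?_
    rw [mul_assoc]
    refine mul_le_mul_of_nonneg_left ?_ hC
    have h1 : ∫ a, |(x : α → ℝ) a| ∂σ = (eLpNorm x 1 σ).toReal := by
      rw [eLpNorm_one_eq_lintegral_enorm, ← integral_norm_eq_lintegral_enorm (hint x).1]
      rfl
    have h2 := eLpNorm_le_eLpNorm_mul_rpow_measure_univ (p := 1) (q := 2) (by norm_num)
      (Lp.aestronglyMeasurable x)
    rw [h1, Lp.norm_def, Measure.real, ENNReal.toReal_rpow, mul_comm, ← ENNReal.toReal_mul]
    refine (ENNReal.toReal_le_toReal (memLp_one_iff_integrable.2 (hint x)).eLpNorm_ne_top ?_).2 ?_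
    · exact ENNReal.mul_ne_top (Lp.eLpNorm_ne_top x) (by finiteness)
    · convert h2 using 3
      norm_num
  let Gc : StrongDual ℝ (Lp ℝ 2 σ) := G.mkContinuous _ hbound
  let κ : Lp ℝ 2 σ := (InnerProductSpace.toDual ℝ _).symm Gc
  have hκ : ∀ x : Lp ℝ 2 σ, G x = ∫ a, (x : α → ℝ) a * (κ : α → ℝ) a ∂σ := fun x => by
    have : ⟪κ, x⟫ = Gc x := InnerProductSpace.toDual_symm_apply
    rw [show G x = Gc x from rfl, ← this, L2.inner_def]
    simp
  have hsi : ∀ s, MeasurableSet s → |∫ a in s, (κ : α → ℝ) a ∂σ| ≤ C * σ.real s := by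
    intro s hs
    have hx := hGabs (indicatorConstLp 2 hs (measure_ne_top σ s) (1 : ℝ))
    have he := indicatorConstLp_coeFn (p := 2) (hs := hs) (hμs := measure_ne_top σ s) (c := (1 : ℝ))
    rw [hκ] at hx
    rw [integral_congr_ae (g := s.indicator κ) (he.mono fun a ha => by
      by_cases h : a ∈ s <;> simp [ha, h]), integral_indicator hs] at hx
    rw [integral_congr_ae (g := s.indicator fun _ => (1 : ℝ)) (he.mono fun a ha => by
      by_cases h : a ∈ s <;> simp [ha, h])] at hx
    simpa [integral_indicator hs, Measure.real] using hx
  have hup : ∀ᵐ a ∂σ, (κ : α → ℝ) a ≤ C :=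
    ae_le_of_forall_setIntegral_le (hint κ) (integrable_const C) fun s hs _ => by
      have := (abs_le.1 (hsi s hs)).2
      simpa [mul_comm] using this
  have hlow : ∀ᵐ a ∂σ, -C ≤ (κ : α → ℝ) a :=
    ae_le_of_forall_setIntegral_le (integrable_const _) (hint κ) fun s hs _ => by
      have := (abs_le.1 (hsi s hs)).1
      simpa [mul_comm] using this
  obtain ⟨k, hk, hkκ⟩ := (Lp.aestronglyMeasurable κ).aemeasurable
  refine ⟨k, hk, ?_, fun f => ?_⟩
  · filter_upwards [hup, hlow, hkκ] with a h1 h2 h3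
    exact abs_le.2 ⟨h3 ▸ h2, h3 ▸ h1⟩
  · rw [← hGT, hκ]
    exact integral_congr_ae ((hT f).mp (hkκ.mono fun a h1 h2 => by simp only [h1, h2]))

/-- A bounded signed density with respect to `σ` splits into two mutually singular positive
measures whose sum is dominated by a multiple of `σ`. -/
theorem exists_mutuallySingular_of_density {α : Type*} [MeasurableSpace α] (σ : Measure α)
    [IsFiniteMeasure σ] {C : ℝ} {k : α → ℝ} (hk : Measurable k) (hkC : ∀ᵐ a ∂σ, |k a| ≤ C) :
    ∃ μp μn : Measure α, μp.MutuallySingular μn ∧ μp + μn ≤ ENNReal.ofReal C • σ ∧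
      ∀ f : α → ℝ, Integrable f σ →
        ∫ a, f a * k a ∂σ = ∫ a, f a ∂μp - ∫ a, f a ∂μn := by
  have hm : Measurable fun a => ENNReal.ofReal (k a) := hk.ennreal_ofReal
  have hm' : Measurable fun a => ENNReal.ofReal (-k a) := hk.neg.ennreal_ofReal
  refine ⟨σ.withDensity fun a => ENNReal.ofReal (k a),
    σ.withDensity fun a => ENNReal.ofReal (-k a), ?_, ?_, fun f hf => ?_⟩
  · refine ⟨{a | k a ≤ 0}, measurableSet_le hk measurable_const, ?_, ?_⟩
    · rw [withDensity_apply_eq_zero hm, ← measure_empty (μ := σ)]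
      congr 1
      ext a
      simp
    · rw [withDensity_apply_eq_zero hm', ← measure_empty (μ := σ)]
      congr 1
      ext a
      simp
      exact fun h => h.le
  · rw [← withDensity_add_left hm, ← withDensity_const]
    refine withDensity_mono (hkC.mono fun a ha => ?_)
    rw [Pi.add_apply]
    rcases le_total 0 (k a) with h | h
    · rw [ENNReal.ofReal_of_nonpos (neg_nonpos.2 h), add_zero]
      exact ENNReal.ofReal_le_ofReal ((le_abs_self _).trans ha)
    · rw [ENNReal.ofReal_of_nonpos h, zero_add]
      exact ENNReal.ofReal_le_ofReal ((neg_le_abs _).trans ha)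
  · rw [integral_withDensity_eq_integral_toReal_smul hm (by simp),
      integral_withDensity_eq_integral_toReal_smul hm' (by simp), ← integral_sub]
    · refine integral_congr_ae (Eventually.of_forall fun a => ?_)
      rcases le_total 0 (k a) with h | h
      · simp [ENNReal.toReal_ofReal', h, mul_comm]
      · simp [ENNReal.toReal_ofReal', h, mul_comm]
    · refine hf.bdd_mul (c := C) hm.ennreal_toReal.aestronglyMeasurable (hkC.mono fun a ha => ?_)
      rw [Real.norm_of_nonneg ENNReal.toReal_nonneg, ENNReal.toReal_ofReal']
      exact max_le ((le_abs_self _).trans ha) ((abs_nonneg _).trans ha)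
    · refine hf.bdd_mul (c := C) hm'.ennreal_toReal.aestronglyMeasurable (hkC.mono fun a ha => ?_)
      rw [Real.norm_of_nonneg ENNReal.toReal_nonneg, ENNReal.toReal_ofReal']
      exact max_le ((neg_le_abs _).trans ha) ((abs_nonneg _).trans ha)

section Mollification

open scoped Convolution
open ContinuousLinearMap (lsmul)

variable {V W W' : Type*} [NormedAddCommGroup V] [NormedSpace ℝ V] [FiniteDimensional ℝ V]
  [MeasurableSpace V] [BorelSpace V] {μ : Measure V} [μ.IsAddHaarMeasure]
  [NormedAddCommGroup W] [NormedSpace ℝ W] [NormedAddCommGroup W'] [NormedSpace ℝ W']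

theorem ContDiffBump.normed_convolution_apply (η : ContDiffBump (0 : V)) (f : V → W) (y : V) :
    (η.normed μ ⋆[lsmul ℝ ℝ, μ] f) y = ∫ z, η.normed μ (z - y) • f z ∂μ := by
  rw [convolution_eq_swap]
  congr 1 with z
  rw [← η.normed_neg, neg_sub]
  rfl

theorem ContDiffBump.norm_normed_convolution_le (η : ContDiffBump (0 : V)) {f : V → W} {C : ℝ}
    (hf : ∀ᵐ z ∂μ, ‖f z‖ ≤ C) (y : V) : ‖(η.normed μ ⋆[lsmul ℝ ℝ, μ] f) y‖ ≤ C := by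
  rw [η.normed_convolution_apply]
  have hi : Integrable (fun z => η.normed μ (z - y) * C) μ :=
    (η.integrable_normed.comp_sub_right y).mul_const C
  refine (norm_integral_le_of_norm_le hi (hf.mono fun z hz => ?_)).trans_eq ?_
  · rw [norm_smul, Real.norm_of_nonneg (η.nonneg_normed _)]
    exact mul_le_mul_of_nonneg_left hz (η.nonneg_normed _)
  · rw [integral_mul_const, integral_sub_right_eq_self (fun z => η.normed μ z) y,
      η.integral_normed, one_mul]

/-- Bounded functions may be mollified inside a bilinear pairing with an integrable function. -/
theorem tendsto_integral_normed_convolution {η : ℕ → ContDiffBump (0 : V)} {f : V → W} {C : ℝ}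
    (hfm : AEStronglyMeasurable f μ) (hf : ∀ᵐ z ∂μ, ‖f z‖ ≤ C) {ν : Measure V}
    (hlim : ∀ᵐ y ∂ν, Tendsto (fun n => ((η n).normed μ ⋆[lsmul ℝ ℝ, μ] f) y) atTop (𝓝 (f y)))
    {w : V → W'} (hw : Integrable w ν) (B : W →L[ℝ] W' →L[ℝ] ℝ) :
    Tendsto (fun n => ∫ y, B (((η n).normed μ ⋆[lsmul ℝ ℝ, μ] f) y) (w y) ∂ν) atTop
      (𝓝 (∫ y, B (f y) (w y) ∂ν)) := by
  have hloc : LocallyIntegrable f μ :=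
    ((memLp_top_of_bound hfm C hf).locallyIntegrable le_top)
  refine tendsto_integral_of_dominated_convergence (fun y => ‖B‖ * C * ‖w y‖) (fun n => ?_)
    (hw.norm.const_mul _) (fun n => Eventually.of_forall fun y => ?_) (hlim.mono fun y hy => ?_)
  · have hc : Continuous ((η n).normed μ ⋆[lsmul ℝ ℝ, μ] f) :=
      (η n).hasCompactSupport_normed.continuous_convolution_left _ (η n).continuous_normed hloc
    exact B.aestronglyMeasurable_comp₂ hc.aestronglyMeasurable hw.1
  · refine (B.le_opNorm₂ _ _).trans ?_
    gcongr
    exact (η n).norm_normed_convolution_le hf y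
  · exact ((B.flip (w y)).continuous.tendsto _).comp hy

theorem tendsto_setIntegral_normed_convolution [CompleteSpace W] {η : ℕ → ContDiffBump (0 : V)}
    {K : ℝ} (hη0 : Tendsto (fun n => (η n).rOut) atTop (𝓝 0))
    (hηK : ∀ᶠ n in atTop, (η n).rOut ≤ K * (η n).rIn) {f : V → W} {C : ℝ}
    (hfm : AEStronglyMeasurable f μ) (hf : ∀ᵐ z ∂μ, ‖f z‖ ≤ C) {s : Set V}
    {w : V → W'} (hw : IntegrableOn w s μ) (B : W →L[ℝ] W' →L[ℝ] ℝ) :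
    Tendsto (fun n => ∫ y in s, B (((η n).normed μ ⋆[lsmul ℝ ℝ, μ] f) y) (w y) ∂μ) atTop
      (𝓝 (∫ y in s, B (f y) (w y) ∂μ)) :=
  tendsto_integral_normed_convolution hfm hf
    (ae_restrict_of_ae (ContDiffBump.ae_convolution_tendsto_right_of_locallyIntegrable
      hη0 hηK ((memLp_top_of_bound hfm C hf).locallyIntegrable le_top))) hw B

end Mollification

section Translation

variable {V : Type*} [NormedAddCommGroup V] [NormedSpace ℝ V] {θ φ : V → ℝ}

theorem fderiv_comp_const_sub_apply (hθ : Differentiable ℝ θ) (z y w : V) :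
    fderiv ℝ (fun y => θ (z - y)) y w = -fderiv ℝ θ (z - y) w := by
  have := ((hθ (z - y)).hasFDerivAt).comp y ((hasFDerivAt_id y).const_sub z)
  rw [show (fun y => θ (z - y)) = θ ∘ fun y => z - y from rfl]
  rw [this.fderiv]
  simp

theorem fderiv_comp_sub_const_mul_apply (hθ : Differentiable ℝ θ) (hφ : Differentiable ℝ φ)
    (y z w : V) : fderiv ℝ (fun z => θ (z - y) * φ z) z w
      = θ (z - y) * fderiv ℝ φ z w + φ z * fderiv ℝ θ (z - y) w := by
  have h : Differentiable ℝ fun z => θ (z - y) := hθ.comp (differentiable_id.sub_const y)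
  rw [fderiv_fun_mul (h z) (hφ z), fderiv_comp_sub]
  rfl

end Translation

section SpaceTime

variable {E : Type*} [NormedAddCommGroup E] [NormedSpace ℝ E] [FiniteDimensional ℝ E]
  [MeasureSpace E] [BorelSpace E] [(volume : Measure E).IsAddHaarMeasure]

theorem integrable_apply_of_bounded {c : E × ℝ → (E × ℝ →L[ℝ] ℝ)} (hc : Continuous c)
    (hcs : HasCompactSupport c) {u : E × ℝ → E} (hu : Measurable u) {Cu : ℝ}
    (hCu : ∀ᵐ z, ‖u z‖ ≤ Cu) : Integrable fun z => c z (u z, (0 : ℝ)) := by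
  refine Integrable.mono' ((hc.integrable_of_hasCompactSupport hcs).norm.mul_const Cu) ?_
    (hCu.mono fun z hz => ?_)
  · exact (ContinuousLinearMap.apply ℝ ℝ).flip.aestronglyMeasurable_comp₂ hc.aestronglyMeasurable
      (hu.prodMk measurable_const).aestronglyMeasurable
  · refine ((c z).le_opNorm _).trans ?_
    gcongr
    simpa using hz

/-- If almost every time slice of `u` is divergence free, then `u` is divergence free in
space-time. -/
theorem integral_fderiv_apply_eq_zero {Ω : Set E} {T : ℝ}
    {u : E × ℝ → E} (hu : Measurable u) {Cu : ℝ} (hCu : ∀ᵐ z, ‖u z‖ ≤ Cu)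
    (hdiv : ∀ᵐ t : ℝ, ∀ φ : E → ℝ, ContDiff ℝ (⊤ : ℕ∞) φ → HasCompactSupport φ →
      tsupport φ ⊆ Ω → ∫ x in Ω, fderiv ℝ φ x (u (x, t)) = 0)
    {ψ : E × ℝ → ℝ} (hψ : ContDiff ℝ (⊤ : ℕ∞) ψ) (hψc : HasCompactSupport ψ)
    (hψs : tsupport ψ ⊆ Ω ×ˢ Ioo (0 : ℝ) T) :
    ∫ z, fderiv ℝ ψ z (u z, (0 : ℝ)) = 0 := by
  have hint := integrable_apply_of_bounded (hψ.continuous_fderiv (by simp))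
    (hψc.fderiv (𝕜 := ℝ)) hu hCu
  rw [Measure.volume_eq_prod] at hint ⊢
  rw [integral_prod_symm _ hint]
  refine integral_eq_zero_of_ae (hdiv.mono fun t ht => ?_)
  have hemb : IsClosedEmbedding fun x : E => (x, t) :=
    ⟨isEmbedding_prodMkLeft t, by
      have : range (fun x : E => (x, t)) = univ ×ˢ {t} := by
        ext ⟨a, b⟩; simp [eq_comm]
      rw [this]
      exact isClosed_univ.prod isClosed_singleton⟩
  have hpre : tsupport (fun x => ψ (x, t)) ⊆ (fun x : E => (x, t)) ⁻¹' tsupport ψ :=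
    closure_minimal (fun _ hy => subset_tsupport ψ hy)
      ((isClosed_tsupport ψ).preimage hemb.continuous)
  have hsub : tsupport (fun x => ψ (x, t)) ⊆ Ω := fun x hx => (hψs (hpre hx)).1
  have hfd : ∀ x v, fderiv ℝ (fun x => ψ (x, t)) x v = fderiv ℝ ψ (x, t) (v, (0 : ℝ)) := by
    intro x v
    have h1 : HasFDerivAt ψ (fderiv ℝ ψ (x, t)) (x, t) :=
      (hψ.differentiable (by simp) _).hasFDerivAt
    have h2 := h1.comp x (hasFDerivAt_prodMk_left (𝕜 := ℝ) x t)
    rw [show (fun x => ψ (x, t)) = ψ ∘ fun x => (x, t) from rfl, h2.fderiv]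
    rfl
  have := ht (fun x => ψ (x, t)) (hψ.comp (contDiff_id.prodMk contDiff_const))
    (hψc.comp_isClosedEmbedding hemb) hsub
  rw [setIntegral_eq_integral_of_forall_compl_eq_zero] at this
  · simpa only [hfd, Pi.zero_apply] using this
  · intro x hx
    have : fderiv ℝ (fun x => ψ (x, t)) x = 0 :=
      image_eq_zero_of_notMem_tsupport fun h => hx (hsub (tsupport_fderiv_subset ℝ h))
    rw [this]
    rfl

theorem isAddHaarMeasure_volume_prod_real : (volume : Measure (E × ℝ)).IsAddHaarMeasure :=
  inferInstanceAs ((volume : Measure E).prod (volume : Measure ℝ)).IsAddHaarMeasure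

section Estimate

open scoped Convolution
open ContinuousLinearMap (lsmul)

variable {u : E × ℝ → E} {Cu : ℝ} {Q : Set (E × ℝ)} {ρ : E × ℝ → ℝ}
  {G : E × ℝ → (E →L[ℝ] ℝ)} {σ : Measure (E × ℝ)}

/-- The commutator identity for one mollifier, in the form of an estimate: the mollified
distribution `div (ρ u) - u · G` is controlled by the mollified test function against `σ`. -/
theorem abs_mollified_divergence_le [IsFiniteMeasure σ]
    (hu : Measurable u) (hCu : ∀ᵐ z, ‖u z‖ ≤ Cu)
    (hdiv : ∀ ψ : E × ℝ → ℝ, ContDiff ℝ (⊤ : ℕ∞) ψ → HasCompactSupport ψ → tsupport ψ ⊆ Q →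
      ∫ z, fderiv ℝ ψ z (u z, (0 : ℝ)) = 0)
    (hρ : IntegrableOn ρ Q) (hG : IntegrableOn G Q)
    (hgrad : ∀ φ : E × ℝ → ℝ, ContDiff ℝ (⊤ : ℕ∞) φ → HasCompactSupport φ → tsupport φ ⊆ Q →
      ∀ v : E, |(∫ z in Q, ρ z * fderiv ℝ φ z (v, (0 : ℝ))) + ∫ z in Q, φ z * G z v|
        ≤ ‖v‖ * ∫ z, |φ z| ∂σ)
    {φ : E × ℝ → ℝ} (hφ : ContDiff ℝ (⊤ : ℕ∞) φ) (hφc : HasCompactSupport φ)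
    (hφQ : tsupport φ ⊆ Q) (η : ContDiffBump (0 : E × ℝ))
    (hη : ∀ z ∈ tsupport φ, closedBall z η.rOut ⊆ Q) :
    |(∫ y in Q, ρ y * (η.normed volume ⋆[lsmul ℝ ℝ, volume]
        fun z => fderiv ℝ φ z (u z, (0 : ℝ))) y)
      + ∫ y in Q, G y ((η.normed volume ⋆[lsmul ℝ ℝ, volume] fun z => φ z • u z) y)|
      ≤ Cu * ∫ y, (η.normed volume ⋆[lsmul ℝ ℝ, volume] fun z => |φ z|) y ∂σ := by
  have : (volume : Measure (E × ℝ)).IsAddHaarMeasure := isAddHaarMeasure_volume_prod_real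
  set θ : E × ℝ → ℝ := η.normed volume with hθ
  have hθd : ContDiff ℝ (⊤ : ℕ∞) θ := η.contDiff_normed
  have hθc : HasCompactSupport θ := η.hasCompactSupport_normed
  have hθ0 : ∀ z, 0 ≤ θ z := η.nonneg_normed
  have hθD : Continuous (fderiv ℝ θ) := hθd.continuous_fderiv (by simp)
  have hφD : Continuous (fderiv ℝ φ) := hφ.continuous_fderiv (by simp)
  have hθdiff : Differentiable ℝ θ := hθd.differentiable (by simp)
  have hφdiff : Differentiable ℝ φ := hφ.differentiable (by simp)
  obtain ⟨M, hM⟩ := hθc.exists_bound_of_continuous hθd.continuous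
  obtain ⟨M', hM'⟩ := (hθc.fderiv (𝕜 := ℝ)).exists_bound_of_continuous hθD
  have hM0 : 0 ≤ M := (norm_nonneg _).trans (hM 0)
  have hM0' : 0 ≤ M' := (norm_nonneg _).trans (hM' 0)
  have hφi : Integrable φ := hφ.continuous.integrable_of_hasCompactSupport hφc
  have huv : Measurable fun z => (u z, (0 : ℝ)) := hu.prodMk measurable_const
  -- the three kernels
  have hK₁ : Integrable (fun p : (E × ℝ) × (E × ℝ) =>
      φ p.1 * (ρ p.2 * fderiv ℝ θ (p.1 - p.2) (u p.1, (0 : ℝ))))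
      (volume.prod (volume.restrict Q)) := by
    refine Integrable.mono' ((hφi.mul_prod hρ).norm.mul_const (M' * Cu)) ?_ ?_
    · refine hφi.1.comp_fst.mul (hρ.1.comp_snd.mul ?_)
      exact (ContinuousLinearMap.apply ℝ ℝ).flip.aestronglyMeasurable_comp₂
        (hθD.comp (continuous_fst.sub continuous_snd)).aestronglyMeasurable
        (huv.comp measurable_fst).aestronglyMeasurable
    · filter_upwards [Measure.quasiMeasurePreserving_fst.ae hCu] with p hp
      rw [← mul_assoc, norm_mul]
      refine mul_le_mul_of_nonneg_left ?_ (norm_nonneg _)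
      refine ((fderiv ℝ θ (p.1 - p.2)).le_opNorm _).trans ?_
      gcongr
      · exact hM' _
      · simpa using hp
  have hK₂ : Integrable (fun p : (E × ℝ) × (E × ℝ) =>
      φ p.1 * (θ (p.1 - p.2) * G p.2 (u p.1))) (volume.prod (volume.restrict Q)) := by
    refine Integrable.mono' ((hφi.norm.mul_prod hG.norm).mul_const (M * Cu)) ?_ ?_
    · refine hφi.1.comp_fst.mul (AEStronglyMeasurable.mul ?_ ?_)
      · exact (hθd.continuous.comp (continuous_fst.sub continuous_snd)).aestronglyMeasurable
      · exact (ContinuousLinearMap.apply ℝ ℝ).flip.aestronglyMeasurable_comp₂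
          hG.1.comp_snd (hu.comp measurable_fst).aestronglyMeasurable
    · filter_upwards [Measure.quasiMeasurePreserving_fst.ae hCu] with p hp
      have h1 : ‖G p.2 (u p.1)‖ ≤ ‖G p.2‖ * Cu := ((G p.2).le_opNorm _).trans (by gcongr)
      calc ‖φ p.1 * (θ (p.1 - p.2) * G p.2 (u p.1))‖
          = ‖φ p.1‖ * (‖θ (p.1 - p.2)‖ * ‖G p.2 (u p.1)‖) := by rw [norm_mul, norm_mul]
        _ ≤ ‖φ p.1‖ * (M * (‖G p.2‖ * Cu)) := by gcongr; exact hM _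
        _ = _ := by ring
  have hK₃ : Integrable (fun p : (E × ℝ) × (E × ℝ) => θ (p.1 - p.2) * |φ p.1|)
      (volume.prod σ) := by
    refine Integrable.mono' ((hφi.abs.mul_prod (integrable_const (1 : ℝ) (μ := σ))).mul_const M)
      ?_ (Eventually.of_forall fun p => ?_)
    · exact ((hθd.continuous.comp (continuous_fst.sub continuous_snd)).mul
        (hφ.continuous.abs.comp continuous_fst)).aestronglyMeasurable
    · rw [norm_mul, mul_one, mul_comm, Real.norm_eq_abs, abs_abs]
      exact mul_le_mul_of_nonneg_left (hM _) (abs_nonneg _)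
  -- the divergence free condition against `θ (· - y) φ`
  have hI₁ : ∀ y, ∫ z, φ z * (ρ y * fderiv ℝ θ (z - y) (u z, (0 : ℝ)))
      = -(ρ y * (θ ⋆[lsmul ℝ ℝ, volume] fun z => fderiv ℝ φ z (u z, (0 : ℝ))) y) := by
    intro y
    have hs : ContDiff ℝ (⊤ : ℕ∞) fun z => θ (z - y) := hθd.comp (contDiff_id.sub contDiff_const)
    have h0 := hdiv (fun z => θ (z - y) * φ z) (hs.mul hφ) hφc.mul_left
      ((tsupport_mul_subset_right (f := fun z => θ (z - y))).trans hφQ)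
    have hi₁ : Integrable fun z => θ (z - y) * fderiv ℝ φ z (u z, (0 : ℝ)) :=
      (integrable_apply_of_bounded hφD (hφc.fderiv (𝕜 := ℝ)) hu hCu).bdd_mul
        hs.continuous.aestronglyMeasurable (Eventually.of_forall fun z => hM _)
    have hi₂ : Integrable fun z => φ z * fderiv ℝ θ (z - y) (u z, (0 : ℝ)) := by
      refine hφi.mul_bdd (c := M' * Cu) ?_ (hCu.mono fun z hz => ?_)
      · exact (ContinuousLinearMap.apply ℝ ℝ).flip.aestronglyMeasurable_comp₂
          (hθD.comp (continuous_id.sub continuous_const)).aestronglyMeasurable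
          huv.aestronglyMeasurable
      · refine ((fderiv ℝ θ (z - y)).le_opNorm _).trans ?_
        gcongr
        · exact hM' _
        · simpa using hz
    simp only [fderiv_comp_sub_const_mul_apply hθdiff hφdiff] at h0
    rw [integral_add hi₁ hi₂] at h0
    simp only [mul_left_comm (φ _) (ρ y)]
    rw [integral_const_mul, η.normed_convolution_apply]
    simp only [smul_eq_mul]
    linear_combination ρ y * h0
  have hI₂ : ∀ y, ∫ z, φ z * (θ (z - y) * G y (u z))
      = G y ((θ ⋆[lsmul ℝ ℝ, volume] fun z => φ z • u z) y) := by
    intro y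
    rw [η.normed_convolution_apply, ← ContinuousLinearMap.integral_comp_comm]
    · congr 1 with z
      simp only [map_smul, smul_eq_mul]
      ring
    · simp only [smul_smul]
      refine Integrable.mono' ((hφi.norm.const_mul M).mul_const Cu) ?_ ?_
      · exact (((hθd.continuous.comp (continuous_id.sub continuous_const)).mul
          hφ.continuous).aestronglyMeasurable).smul hu.aestronglyMeasurable
      · filter_upwards [hCu] with z hz
        rw [norm_smul, norm_mul]
        gcongr
        exact hM _
  -- the gradient bound against `θ (z - ·)`
  have hA : ∀ z, |φ z * ((∫ y in Q, ρ y * fderiv ℝ θ (z - y) (u z, (0 : ℝ)))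
      - ∫ y in Q, θ (z - y) * G y (u z))| ≤ ‖u z‖ * ∫ y, θ (z - y) * |φ z| ∂σ := by
    intro z
    by_cases hz : φ z = 0
    · simp [hz]
    have hzs : z ∈ tsupport φ := subset_tsupport φ hz
    have hs : ContDiff ℝ (⊤ : ℕ∞) fun y => θ (z - y) := hθd.comp (contDiff_const.sub contDiff_id)
    have hsupp : tsupport (fun y => θ (z - y)) ⊆ closedBall z η.rOut := by
      refine closure_minimal (fun y hy => ?_) isClosed_closedBall
      have : z - y ∈ Function.support θ := hy
      rw [hθ, η.support_normed_eq, mem_ball_zero_iff] at this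
      rw [mem_closedBall, dist_comm, dist_eq_norm]
      exact this.le
    have hcs : HasCompactSupport fun y => θ (z - y) :=
      (isCompact_closedBall z η.rOut).of_isClosed_subset (isClosed_tsupport _) hsupp
    have := hgrad _ hs hcs (hsupp.trans (hη z hzs)) (u z)
    simp only [fderiv_comp_const_sub_apply hθdiff, mul_neg, integral_neg, abs_of_nonneg (hθ0 _)]
      at this
    rw [abs_mul, integral_mul_const, ← mul_assoc, mul_comm |φ z|]
    refine mul_le_mul_of_nonneg_right ?_ (abs_nonneg _)
    rwa [neg_add_eq_sub, abs_sub_comm] at this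
  have h₁ : ∫ y in Q, ρ y * (θ ⋆[lsmul ℝ ℝ, volume] fun z => fderiv ℝ φ z (u z, (0 : ℝ))) y
      = -∫ z, φ z * ∫ y in Q, ρ y * fderiv ℝ θ (z - y) (u z, (0 : ℝ)) := by
    simp only [← integral_const_mul]
    rw [integral_integral_swap hK₁]
    simp only [hI₁, integral_neg, neg_neg]
  have h₂ : ∫ y in Q, G y ((θ ⋆[lsmul ℝ ℝ, volume] fun z => φ z • u z) y)
      = ∫ z, φ z * ∫ y in Q, θ (z - y) * G y (u z) := by
    simp only [← integral_const_mul]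
    rw [integral_integral_swap hK₂]
    simp only [hI₂]
  have h₃ : ∫ y, (θ ⋆[lsmul ℝ ℝ, volume] fun z => |φ z|) y ∂σ
      = ∫ z, ∫ y, θ (z - y) * |φ z| ∂σ := by
    rw [integral_integral_swap hK₃]
    simp only [hθ, η.normed_convolution_apply, smul_eq_mul]
  have hi₁ : Integrable fun z => φ z * ∫ y in Q, ρ y * fderiv ℝ θ (z - y) (u z, (0 : ℝ)) := by
    simpa only [integral_const_mul] using hK₁.integral_prod_left
  have hi₂ : Integrable fun z => φ z * ∫ y in Q, θ (z - y) * G y (u z) := by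
    simpa only [integral_const_mul] using hK₂.integral_prod_left
  rw [h₁, h₂, h₃, neg_add_eq_sub, abs_sub_comm, ← integral_sub hi₁ hi₂, ← integral_const_mul]
  refine norm_integral_le_of_norm_le (G := ℝ) (hK₃.integral_prod_left.const_mul Cu)
    (hCu.mono fun z hz => ?_)
  rw [← mul_sub]
  exact (hA z).trans (mul_le_mul_of_nonneg_right hz
    (integral_nonneg fun y => mul_nonneg (hθ0 _) (abs_nonneg _)))

/-- Passing to the limit in `abs_mollified_divergence_le`. -/
theorem abs_divergence_le [IsFiniteMeasure σ] (hQ : IsOpen Q)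
    (hu : Measurable u) (hCu : ∀ᵐ z, ‖u z‖ ≤ Cu)
    (hdiv : ∀ ψ : E × ℝ → ℝ, ContDiff ℝ (⊤ : ℕ∞) ψ → HasCompactSupport ψ → tsupport ψ ⊆ Q →
      ∫ z, fderiv ℝ ψ z (u z, (0 : ℝ)) = 0)
    (hρ : IntegrableOn ρ Q) (hG : IntegrableOn G Q)
    (hgrad : ∀ φ : E × ℝ → ℝ, ContDiff ℝ (⊤ : ℕ∞) φ → HasCompactSupport φ → tsupport φ ⊆ Q →
      ∀ v : E, |(∫ z in Q, ρ z * fderiv ℝ φ z (v, (0 : ℝ))) + ∫ z in Q, φ z * G z v|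
        ≤ ‖v‖ * ∫ z, |φ z| ∂σ)
    {φ : E × ℝ → ℝ} (hφ : ContDiff ℝ (⊤ : ℕ∞) φ) (hφc : HasCompactSupport φ)
    (hφQ : tsupport φ ⊆ Q) :
    |(∫ z in Q, ρ z * fderiv ℝ φ z (u z, (0 : ℝ))) + ∫ z in Q, φ z * G z (u z)|
      ≤ Cu * ∫ z, |φ z| ∂σ := by
  have : (volume : Measure (E × ℝ)).IsAddHaarMeasure := isAddHaarMeasure_volume_prod_real
  have hφD : Continuous (fderiv ℝ φ) := hφ.continuous_fderiv (by simp)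
  obtain ⟨δ, hδ, hδQ⟩ := hφc.isCompact.exists_cthickening_subset_open hQ hφQ
  obtain ⟨M, hM⟩ := hφc.exists_bound_of_continuous hφ.continuous
  obtain ⟨M', hM'⟩ := (hφc.fderiv (𝕜 := ℝ)).exists_bound_of_continuous hφD
  have hM0 : 0 ≤ M := (norm_nonneg _).trans (hM 0)
  have hM0' : 0 ≤ M' := (norm_nonneg _).trans (hM' 0)
  let η : ℕ → ContDiffBump (0 : E × ℝ) := fun n =>
    { rIn := δ / (n + 1) / 2
      rOut := δ / (n + 1)
      rIn_pos := by positivity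
      rIn_lt_rOut := half_lt_self (by positivity) }
  have hη0 : Tendsto (fun n => (η n).rOut) atTop (𝓝 0) := by
    have := (tendsto_one_div_add_atTop_nhds_zero_nat (𝕜 := ℝ)).const_mul δ
    simpa [η, div_eq_mul_inv] using this
  have hηK : ∀ᶠ n in atTop, (η n).rOut ≤ 2 * (η n).rIn :=
    Eventually.of_forall fun n => by simp only [η]; linarith
  have hηQ : ∀ n, ∀ z ∈ tsupport φ, closedBall z (η n).rOut ⊆ Q := fun n z hz =>
    (closedBall_subset_cthickening hz _).trans
      ((cthickening_mono (div_le_self hδ.le (by simp)) _).trans hδQ)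
  have hfm : AEStronglyMeasurable (fun z => fderiv ℝ φ z (u z, (0 : ℝ))) :=
    (integrable_apply_of_bounded hφD (hφc.fderiv (𝕜 := ℝ)) hu hCu).1
  have hfb : ∀ᵐ z, ‖fderiv ℝ φ z (u z, (0 : ℝ))‖ ≤ M' * Cu := hCu.mono fun z hz =>
    ((fderiv ℝ φ z).le_opNorm _).trans (by gcongr; exacts [hM' z, by simpa using hz])
  have hFm : AEStronglyMeasurable (fun z => φ z • u z) :=
    hφ.continuous.aestronglyMeasurable.smul hu.aestronglyMeasurable
  have hFb : ∀ᵐ z, ‖φ z • u z‖ ≤ M * Cu := hCu.mono fun z hz => by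
    rw [norm_smul]; gcongr; exact hM z
  have l₁ := tendsto_setIntegral_normed_convolution hη0 hηK hfm hfb hρ
    (ContinuousLinearMap.mul ℝ ℝ)
  have l₂ := tendsto_setIntegral_normed_convolution hη0 hηK hFm hFb hG
    (ContinuousLinearMap.apply ℝ ℝ)
  have l₃ := tendsto_integral_normed_convolution (μ := volume) (ν := σ) (f := fun z => |φ z|)
    (C := M) hφ.continuous.abs.aestronglyMeasurable
    (Eventually.of_forall fun z => by simpa using hM z)
    (Eventually.of_forall
      (ContDiffBump.convolution_tendsto_right_of_continuous hη0 hφ.continuous.abs))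
    (integrable_const (1 : ℝ)) (ContinuousLinearMap.mul ℝ ℝ)
  simp only [ContinuousLinearMap.mul_apply', mul_one, ContinuousLinearMap.apply_apply,
    map_smul, mul_comm _ (ρ _)] at l₁ l₂ l₃
  exact le_of_tendsto_of_tendsto' (l₁.add l₂).abs (l₃.const_mul Cu) fun n =>
    abs_mollified_divergence_le hu hCu hdiv hρ hG hgrad hφ hφc hφQ (η n) (hηQ n)

end Estimate

end SpaceTime

/-- Smooth functions with compact support contained in `Q`. -/
def smoothCompactlySupportedIn {V : Type*} [NormedAddCommGroup V] [NormedSpace ℝ V] (Q : Set V) :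
    Submodule ℝ (V → ℝ) where
  carrier := {φ | ContDiff ℝ (⊤ : ℕ∞) φ ∧ HasCompactSupport φ ∧ tsupport φ ⊆ Q}
  zero_mem' := ⟨contDiff_const, HasCompactSupport.zero, by simp [tsupport]⟩
  add_mem' := fun hf hg => ⟨hf.1.add hg.1, hf.2.1.add hg.2.1,
    (tsupport_add _ _).trans (union_subset hf.2.2 hg.2.2)⟩
  smul_mem' := fun c f hf => ⟨contDiff_const.smul hf.1, hf.2.1.smul_left (f := fun _ => c),
    (tsupport_smul_subset_right (fun _ => c) f).trans hf.2.2⟩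

/-- for bounded `u` with `div_x u_t = 0` for a.e. `t` and `ρ ∈ L¹` whose
distributional spatial gradient is a finite vector measure `∇ρ = g·L^{d+1} + h·σ`
(with `σ ⊥ L^{d+1}`, `‖h‖ = 1` σ-a.e.), the distribution `div_x(ρu)` is a finite Borel
measure equal to `u·∇^aρ + μ` with `μ` singular and `|μ| ≤ ‖u‖_∞ |∇^s ρ|`. -/
theorem divergence_of_density_times_velocity
    (d : ℕ) (Ω : Set (EuclideanSpace ℝ (Fin d))) (hΩ : IsOpen Ω) (T : ℝ) (hT : 0 < T)
    (u : EuclideanSpace ℝ (Fin d) × ℝ → EuclideanSpace ℝ (Fin d)) (hum : Measurable u)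
    (Cu : ℝ) (hCu : ∀ᵐ z ∂(volume : Measure (EuclideanSpace ℝ (Fin d) × ℝ)), ‖u z‖ ≤ Cu)
    (hdiv : ∀ᵐ t ∂(volume : Measure ℝ),
      ∀ φ : EuclideanSpace ℝ (Fin d) → ℝ, ContDiff ℝ (⊤ : ℕ∞) φ → HasCompactSupport φ →
        tsupport φ ⊆ Ω → ∫ x in Ω, fderiv ℝ φ x (u (x, t)) ∂volume = 0)
    (ρ : EuclideanSpace ℝ (Fin d) × ℝ → ℝ)
    (hρ : IntegrableOn ρ (Ω ×ˢ Set.Ioo (0:ℝ) T) volume)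
    (g : EuclideanSpace ℝ (Fin d) × ℝ → EuclideanSpace ℝ (Fin d)) (hg : Integrable g volume)
    (σ : Measure (EuclideanSpace ℝ (Fin d) × ℝ)) (hσfin : IsFiniteMeasure σ)
    (hσsing : σ.MutuallySingular volume)
    (h : EuclideanSpace ℝ (Fin d) × ℝ → EuclideanSpace ℝ (Fin d))
    (hh : ∀ᵐ z ∂σ, ‖h z‖ = 1)
    (hgrad : ∀ φ : EuclideanSpace ℝ (Fin d) × ℝ → ℝ, ContDiff ℝ (⊤ : ℕ∞) φ →
      HasCompactSupport φ → tsupport φ ⊆ Ω ×ˢ Set.Ioo (0:ℝ) T →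
      ∀ v : EuclideanSpace ℝ (Fin d),
        ∫ z in Ω ×ˢ Set.Ioo (0:ℝ) T, ρ z * fderiv ℝ φ z (v, (0:ℝ)) ∂volume
          = -(∫ z in Ω ×ˢ Set.Ioo (0:ℝ) T, φ z * ⟪v, g z⟫ ∂volume)
            - ∫ z, φ z * ⟪v, h z⟫ ∂σ) :
    ∃ μp μn : Measure (EuclideanSpace ℝ (Fin d) × ℝ),
      IsFiniteMeasure μp ∧ IsFiniteMeasure μn ∧ μp.MutuallySingular μn ∧
      μp.MutuallySingular volume ∧ μn.MutuallySingular volume ∧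
      μp + μn ≤ (ENNReal.ofReal Cu) • σ ∧
      ∀ φ : EuclideanSpace ℝ (Fin d) × ℝ → ℝ, ContDiff ℝ (⊤ : ℕ∞) φ →
        HasCompactSupport φ → tsupport φ ⊆ Ω ×ˢ Set.Ioo (0:ℝ) T →
        ∫ z in Ω ×ˢ Set.Ioo (0:ℝ) T, ρ z * fderiv ℝ φ z (u z, (0:ℝ)) ∂volume
          = -(∫ z in Ω ×ˢ Set.Ioo (0:ℝ) T, φ z * ⟪u z, g z⟫ ∂volume)
            - (∫ z, φ z ∂μp - ∫ z, φ z ∂μn) := by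
  have hCu0 : 0 ≤ Cu := by
    obtain ⟨z, hz⟩ := hCu.exists
    exact (norm_nonneg _).trans hz
  set Q : Set (EuclideanSpace ℝ (Fin d) × ℝ) := Ω ×ˢ Ioo (0 : ℝ) T with hQdef
  have hQ : IsOpen Q := hΩ.prod isOpen_Ioo
  have hgQ : IntegrableOn g Q := hg.integrableOn
  have hG : IntegrableOn (fun z => innerSL ℝ (g z)) Q := (innerSL ℝ).integrable_comp hgQ
  have hgrad' : ∀ φ : EuclideanSpace ℝ (Fin d) × ℝ → ℝ, ContDiff ℝ (⊤ : ℕ∞) φ →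
      HasCompactSupport φ → tsupport φ ⊆ Q → ∀ v : EuclideanSpace ℝ (Fin d),
      |(∫ z in Q, ρ z * fderiv ℝ φ z (v, (0 : ℝ))) + ∫ z in Q, φ z * innerSL ℝ (g z) v|
        ≤ ‖v‖ * ∫ z, |φ z| ∂σ := by
    intro φ h1 h2 h3 v
    simp only [hgrad φ h1 h2 h3 v, innerSL_apply_apply, real_inner_comm v]
    rw [sub_add_eq_add_sub, neg_add_cancel, zero_sub, abs_neg, ← integral_const_mul]
    refine norm_integral_le_of_norm_le (G := ℝ)
      ((h1.continuous.integrable_of_hasCompactSupport h2).abs.const_mul _)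
      (hh.mono fun z hz => ?_)
    rw [norm_mul, mul_comm, Real.norm_eq_abs (φ z)]
    gcongr
    exact (norm_inner_le_norm _ _).trans_eq (by rw [hz, mul_one])
  have hest : ∀ φ : EuclideanSpace ℝ (Fin d) × ℝ → ℝ, ContDiff ℝ (⊤ : ℕ∞) φ →
      HasCompactSupport φ → tsupport φ ⊆ Q →
      |(∫ z in Q, ρ z * fderiv ℝ φ z (u z, (0 : ℝ))) + ∫ z in Q, φ z * innerSL ℝ (g z) (u z)|
        ≤ Cu * ∫ z, |φ z| ∂σ := fun φ h1 h2 h3 =>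
    abs_divergence_le hQ hum hCu
      (fun ψ h1 h2 h3 => integral_fderiv_apply_eq_zero hum hCu hdiv h1 h2 h3)
      hρ hG hgrad' h1 h2 h3
  have hi₁ : ∀ φ : EuclideanSpace ℝ (Fin d) × ℝ → ℝ, ContDiff ℝ (⊤ : ℕ∞) φ →
      HasCompactSupport φ → IntegrableOn (fun z => ρ z * fderiv ℝ φ z (u z, (0 : ℝ))) Q := by
    intro φ h1 h2
    have hD : Continuous (fderiv ℝ φ) := h1.continuous_fderiv (by simp)
    obtain ⟨M, hM⟩ := (h2.fderiv (𝕜 := ℝ)).exists_bound_of_continuous hD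
    refine Integrable.mul_bdd (c := M * Cu) hρ
      (integrable_apply_of_bounded hD (h2.fderiv (𝕜 := ℝ)) hum hCu).1.restrict
      (ae_restrict_of_ae (hCu.mono fun z hz => ((fderiv ℝ φ z).le_opNorm _).trans ?_))
    have hM0 : 0 ≤ M := (norm_nonneg _).trans (hM 0)
    gcongr
    · exact hM z
    · simpa using hz
  have hi₂ : ∀ φ : EuclideanSpace ℝ (Fin d) × ℝ → ℝ, ContDiff ℝ (⊤ : ℕ∞) φ →
      HasCompactSupport φ → IntegrableOn (fun z => φ z * innerSL ℝ (g z) (u z)) Q := by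
    intro φ h1 h2
    obtain ⟨M, hM⟩ := h2.exists_bound_of_continuous h1.continuous
    refine Integrable.bdd_mul (c := M) ?_ h1.continuous.aestronglyMeasurable
      (Eventually.of_forall hM)
    refine Integrable.mono' (hgQ.norm.mul_const Cu)
      (hgQ.1.inner hum.aestronglyMeasurable) (ae_restrict_of_ae (hCu.mono fun z hz => ?_))
    exact (norm_inner_le_norm (𝕜 := ℝ) (g z) (u z)).trans
      (mul_le_mul_of_nonneg_left hz (norm_nonneg _))
  let L : smoothCompactlySupportedIn Q →ₗ[ℝ] ℝ :=
    { toFun := fun φ => -((∫ z in Q, ρ z * fderiv ℝ φ.1 z (u z, (0 : ℝ)))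
        + ∫ z in Q, φ.1 z * innerSL ℝ (g z) (u z))
      map_add' := by
        rintro ⟨φ, h1, h2, h3⟩ ⟨ψ, k1, k2, k3⟩
        have hd : ∀ z, fderiv ℝ (φ + ψ) z = fderiv ℝ φ z + fderiv ℝ ψ z := fun z =>
          fderiv_add (h1.differentiable (by simp) z) (k1.differentiable (by simp) z)
        simp only [Submodule.coe_add, hd, add_apply, Pi.add_apply, mul_add,
          add_mul]
        rw [integral_add (hi₁ φ h1 h2) (hi₁ ψ k1 k2), integral_add (hi₂ φ h1 h2) (hi₂ ψ k1 k2)]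
        ring
      map_smul' := by
        rintro c ⟨φ, h1, h2, h3⟩
        have hd : ∀ z, fderiv ℝ (c • φ) z = c • fderiv ℝ φ z := fun z =>
          fderiv_const_smul (h1.differentiable (by simp) z) c
        simp only [Submodule.coe_smul, hd, smul_apply, Pi.smul_apply,
          smul_eq_mul, mul_assoc, mul_left_comm _ c, integral_const_mul, RingHom.id_apply]
        ring }
  obtain ⟨k, hk, hkC, hkL⟩ := exists_density_of_abs_le_integral_abs σ hCu0
    (smoothCompactlySupportedIn Q) (fun φ hφ => hφ.1.continuous.memLp_of_hasCompactSupport hφ.2.1)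
    L (fun φ => (abs_neg _).trans_le (hest φ.1 φ.2.1 φ.2.2.1 φ.2.2.2))
  obtain ⟨μp, μn, hpn, hle, hint⟩ := exists_mutuallySingular_of_density σ hk hkC
  have hac : ENNReal.ofReal Cu • σ ≪ σ := Measure.smul_absolutelyContinuous
  have hlep : μp ≤ ENNReal.ofReal Cu • σ := (Measure.le_add_right le_rfl).trans hle
  have hlen : μn ≤ ENNReal.ofReal Cu • σ := (Measure.le_add_left le_rfl).trans hle
  have hfin : IsFiniteMeasure (ENNReal.ofReal Cu • σ) := σ.smul_finite ENNReal.ofReal_ne_top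
  refine ⟨μp, μn, isFiniteMeasure_of_le _ hlep, isFiniteMeasure_of_le _ hlen, hpn,
    hσsing.mono_ac (hlep.absolutelyContinuous.trans hac) .rfl,
    hσsing.mono_ac (hlen.absolutelyContinuous.trans hac) .rfl, hle, fun φ h1 h2 h3 => ?_⟩
  have hL : -((∫ z in Q, ρ z * fderiv ℝ φ z (u z, (0 : ℝ)))
      + ∫ z in Q, φ z * innerSL ℝ (g z) (u z)) = _ := hkL ⟨φ, h1, h2, h3⟩
  rw [hint φ (h1.continuous.integrable_of_hasCompactSupport h2)] at hL
  simp only [innerSL_apply_apply, real_inner_comm (u _)] at hL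
  linear_combination -hL
end

section
/- Let Ω ⊆ ℝ^d be a bounded open set with Lipschitz boundary. Then there exists ε₀ > 0 such that for all ε < ε₀, the Lebesgue measure of the ε-neighborhood of ∂Ω satisfies L^d((∂Ω)_ε) ≤ 2ε H^{d−1}(∂Ω); consequently, for the cutoff χ_ε(x) := min{1, ε⁻¹ dist(x, ∂Ω)} and any Z ∈ L^∞(Ω; ℝ^d), sup_{ε<ε₀} ∫_Ω |Z · ∇χ_ε| dx ≤ 2 ‖Z‖_{L^∞} H^{d−1}(∂Ω). -/
open MeasureTheory Metric Set Filter Topology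
open scoped RealInnerProductSpace

/-- The point of `ℝ^{k+1}` with horizontal part `y` and height `τ`. -/
noncomputable def graphPt {k : ℕ} (y : Fin k → ℝ) (τ : ℝ) : EuclideanSpace ℝ (Fin (k + 1)) :=
  WithLp.toLp 2 (Fin.snoc (α := fun _ => ℝ) y τ)

@[simp] lemma graphPt_castSucc {k : ℕ} (y : Fin k → ℝ) (τ : ℝ) (i : Fin k) :
    graphPt y τ i.castSucc = y i := by
  simp [graphPt]

@[simp] lemma graphPt_last {k : ℕ} (y : Fin k → ℝ) (τ : ℝ) :
    graphPt y τ (Fin.last k) = τ := by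
  simp [graphPt]

lemma graphPt_eta {k : ℕ} (z : EuclideanSpace ℝ (Fin (k + 1))) :
    graphPt (fun i : Fin k => z i.castSucc) (z (Fin.last k)) = z := by
  ext i
  induction i using Fin.lastCases <;> simp

lemma dist_sq_eq {k : ℕ} (z w : EuclideanSpace ℝ (Fin (k + 1))) :
    dist z w ^ 2 = ∑ i : Fin k, (z i.castSucc - w i.castSucc) ^ 2
      + (z (Fin.last k) - w (Fin.last k)) ^ 2 := by
  rw [EuclideanSpace.dist_eq, Real.sq_sqrt (Finset.sum_nonneg fun _ _ => sq_nonneg _),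
    Fin.sum_univ_castSucc]
  simp [Real.dist_eq, sq_abs]

lemma measurePreserving_graphPt (k : ℕ) :
    MeasurePreserving (fun q : (Fin k → ℝ) × ℝ => graphPt q.1 q.2) volume volume := by
  have h1 := (volume_preserving_piFinSuccAbove (fun _ : Fin (k + 1) => ℝ) (Fin.last k)).symm
  have h2 := (EuclideanSpace.volume_preserving_symm_measurableEquiv_toLp (Fin (k + 1))).symm
  have h3 : MeasurePreserving (Prod.swap : (Fin k → ℝ) × ℝ → ℝ × (Fin k → ℝ)) volume volume :=
    Measure.measurePreserving_swap
  refine (?_ : (fun q : (Fin k → ℝ) × ℝ => graphPt q.1 q.2) = _) ▸ h2.comp (h1.comp h3)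
  funext q
  ext i
  induction i using Fin.lastCases <;> simp [MeasurableEquiv.piFinSuccAbove, Fin.insertNthEquiv]

/-- Fubini along the last coordinate in rotated coordinates. -/
lemma volume_eq_lintegral_slices {k : ℕ}
    (A : EuclideanSpace ℝ (Fin (k + 1)) ≃ₗᵢ[ℝ] EuclideanSpace ℝ (Fin (k + 1)))
    {S : Set (EuclideanSpace ℝ (Fin (k + 1)))} (hS : MeasurableSet S) :
    Measurable (fun y : Fin k → ℝ => volume {τ : ℝ | A.symm (graphPt y τ) ∈ S}) ∧
    volume S = ∫⁻ y : Fin k → ℝ, volume {τ : ℝ | A.symm (graphPt y τ) ∈ S} := by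
  have h := A.symm.measurePreserving.comp (measurePreserving_graphPt k)
  have hm := h.measurable hS
  refine ⟨measurable_measure_prodMk_left hm, ?_⟩
  rw [← h.measure_preimage hS.nullMeasurableSet, Measure.volume_eq_prod,
    Measure.prod_apply hm]
  rfl

/-- A ball in which `Ω` is, after a rotation, a Lipschitz subgraph. -/
structure BoundaryChart {k : ℕ} (Ω : Set (EuclideanSpace ℝ (Fin (k + 1)))) where
  center : EuclideanSpace ℝ (Fin (k + 1))
  radius : ℝ
  rot : EuclideanSpace ℝ (Fin (k + 1)) ≃ₗᵢ[ℝ] EuclideanSpace ℝ (Fin (k + 1))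
  toFun : (Fin k → ℝ) → ℝ
  const : NNReal
  lip : LipschitzWith const toFun
  mem_iff : ∀ z ∈ ball center radius,
    (z ∈ Ω ↔ rot z (Fin.last k) < toFun (fun i : Fin k => rot z i.castSucc))

namespace BoundaryChart

variable {k : ℕ} {Ω : Set (EuclideanSpace ℝ (Fin (k + 1)))} (c : BoundaryChart Ω)

/-- The horizontal coordinates of a point. -/
noncomputable def base (z : EuclideanSpace ℝ (Fin (k + 1))) : Fin k → ℝ :=
  fun i => c.rot z i.castSucc

/-- The height of a point. -/
noncomputable def height (z : EuclideanSpace ℝ (Fin (k + 1))) : ℝ := c.rot z (Fin.last k)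

/-- The point with given coordinates. -/
noncomputable def point (y : Fin k → ℝ) (τ : ℝ) : EuclideanSpace ℝ (Fin (k + 1)) :=
  c.rot.symm (graphPt y τ)

/-- The parametrization of the graph. -/
noncomputable def param (y : Fin k → ℝ) : EuclideanSpace ℝ (Fin (k + 1)) :=
  c.point y (c.toFun y)

@[simp] lemma base_point (y : Fin k → ℝ) (τ : ℝ) : c.base (c.point y τ) = y := by
  ext i; simp [base, point]

@[simp] lemma height_point (y : Fin k → ℝ) (τ : ℝ) : c.height (c.point y τ) = τ := by
  simp [height, point]

@[simp] lemma point_base_height (z : EuclideanSpace ℝ (Fin (k + 1))) :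
    c.point (c.base z) (c.height z) = z := by
  have := graphPt_eta (c.rot z)
  exact (congrArg c.rot.symm this).trans (by simp)

@[simp] lemma base_param (y : Fin k → ℝ) : c.base (c.param y) = y := c.base_point _ _

@[simp] lemma height_param (y : Fin k → ℝ) : c.height (c.param y) = c.toFun y :=
  c.height_point _ _

lemma dist_sq (z w : EuclideanSpace ℝ (Fin (k + 1))) :
    dist z w ^ 2 = ∑ i, (c.base z i - c.base w i) ^ 2 + (c.height z - c.height w) ^ 2 := by
  rw [← c.rot.dist_map z w, dist_sq_eq]; rfl

lemma abs_height_sub_le (z w : EuclideanSpace ℝ (Fin (k + 1))) :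
    |c.height z - c.height w| ≤ dist z w := by
  refine abs_le_of_sq_le_sq (b := dist z w) ?_ dist_nonneg
  rw [c.dist_sq]
  have : 0 ≤ ∑ i, (c.base z i - c.base w i) ^ 2 := Finset.sum_nonneg fun _ _ => sq_nonneg _
  linarith

lemma dist_base_le (z w : EuclideanSpace ℝ (Fin (k + 1))) :
    dist (c.base z) (c.base w) ≤ dist z w := by
  refine (dist_pi_le_iff dist_nonneg).2 fun i => ?_
  rw [Real.dist_eq]
  refine abs_le_of_sq_le_sq (b := dist z w) ?_ dist_nonneg
  rw [c.dist_sq]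
  have := Finset.single_le_sum (f := fun i => (c.base z i - c.base w i) ^ 2)
    (fun _ _ => sq_nonneg _) (Finset.mem_univ i)
  have := sq_nonneg (c.height z - c.height w)
  linarith

lemma continuous_base : Continuous c.base := by
  have : LipschitzWith 1 c.base := LipschitzWith.of_dist_le_mul fun z w => by
    simpa using c.dist_base_le z w
  exact this.continuous

lemma continuous_height : Continuous c.height := by
  have : LipschitzWith 1 c.height := LipschitzWith.of_dist_le_mul fun z w => by
    simpa [Real.dist_eq] using c.abs_height_sub_le z w
  exact this.continuous

lemma dist_point_vertical (y : Fin k → ℝ) (τ σ : ℝ) :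
    dist (c.point y τ) (c.point y σ) = |τ - σ| := by
  rw [← abs_of_nonneg (dist_nonneg (x := c.point y τ)), ← sq_eq_sq_iff_abs_eq_abs, c.dist_sq]
  simp

lemma param_injective : Function.Injective c.param := fun y z h => by
  rw [← c.base_param y, h, c.base_param]

/-- A global Lipschitz constant for the parametrization. -/
lemma exists_lipschitzWith_param : ∃ K : NNReal, LipschitzWith K c.param := by
  refine ⟨(√(k + c.const ^ 2)).toNNReal, LipschitzWith.of_dist_le_mul fun y z => ?_⟩
  have h0 := c.lip.dist_le_mul y z
  rw [Real.dist_eq] at h0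
  have h1 : (c.toFun y - c.toFun z) ^ 2 ≤ (c.const * dist y z) ^ 2 := sq_le_sq' (by
    linarith [neg_abs_le (c.toFun y - c.toFun z)]) ((le_abs_self _).trans h0)
  have h2 : ∑ i, (y i - z i) ^ 2 ≤ k * dist y z ^ 2 := by
    have : ∀ i ∈ Finset.univ, (y i - z i) ^ 2 ≤ dist y z ^ 2 := fun i _ => by
      have := dist_le_pi_dist y z i
      rw [Real.dist_eq] at this
      exact sq_le_sq' (by linarith [neg_abs_le (y i - z i)]) ((le_abs_self _).trans this)
    simpa using Finset.sum_le_sum this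
  refine le_of_sq_le_sq (a := dist (c.param y) (c.param z)) ?_ (by positivity)
  rw [c.dist_sq, mul_pow]
  simp only [base_param, height_param, Real.coe_toNNReal _ (Real.sqrt_nonneg _)]
  rw [Real.sq_sqrt (by positivity)]
  nlinarith

lemma continuous_param : Continuous c.param :=
  c.exists_lipschitzWith_param.choose_spec.continuous

lemma mem_ball_iff {z : EuclideanSpace ℝ (Fin (k + 1))} (hz : z ∈ ball c.center c.radius) :
    z ∈ Ω ↔ c.height z < c.toFun (c.base z) := c.mem_iff z hz

lemma mem_frontier_iff (hΩ : IsOpen Ω) {z : EuclideanSpace ℝ (Fin (k + 1))}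
    (hz : z ∈ ball c.center c.radius) :
    z ∈ frontier Ω ↔ c.height z = c.toFun (c.base z) := by
  have hcont : Continuous fun z => c.toFun (c.base z) := c.lip.continuous.comp c.continuous_base
  constructor
  · intro h
    rw [hΩ.frontier_eq] at h
    refine le_antisymm ?_ (not_lt.1 fun h' => h.2 ((c.mem_ball_iff hz).2 h'))
    have hz' : z ∈ closure (Ω ∩ ball c.center c.radius) :=
      by
      rw [inter_comm]; exact isOpen_ball.inter_closure ⟨hz, h.1⟩
    have hcl : IsClosed {z | c.height z ≤ c.toFun (c.base z)} :=
      isClosed_le c.continuous_height hcont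
    exact closure_minimal (fun w hw => ((c.mem_ball_iff hw.2).1 hw.1).le) hcl hz'
  · intro h
    rw [hΩ.frontier_eq]
    refine ⟨?_, fun h' => absurd ((c.mem_ball_iff hz).1 h') (by simp [h])⟩
    have hlim : Tendsto (fun s : ℝ => c.point (c.base z) (c.height z - s)) (𝓝[>] 0) (𝓝 z) := by
      rw [tendsto_iff_dist_tendsto_zero]
      have : ∀ s : ℝ, dist (c.point (c.base z) (c.height z - s)) z = |s| := fun s => by
        conv_lhs => rw [← c.point_base_height z]
        simp only [base_point, height_point]
        rw [c.dist_point_vertical]; simp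
      simp only [this]
      simpa using (continuous_abs.tendsto (0 : ℝ)).mono_left nhdsWithin_le_nhds
    refine mem_closure_of_tendsto hlim ?_
    filter_upwards [hlim (isOpen_ball.mem_nhds hz), self_mem_nhdsWithin] with s hs hs0
    rw [c.mem_ball_iff hs]
    simp only [height_point, base_point, ← h]
    linarith [mem_Ioi.1 hs0]

lemma param_mem_frontier (hΩ : IsOpen Ω) {y : Fin k → ℝ}
    (hy : c.param y ∈ ball c.center c.radius) : c.param y ∈ frontier Ω :=
  (c.mem_frontier_iff hΩ hy).2 (by simp)

lemma param_base (hΩ : IsOpen Ω) {z : EuclideanSpace ℝ (Fin (k + 1))} (h : z ∈ frontier Ω)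
    (hz : z ∈ ball c.center c.radius) : c.param (c.base z) = z := by
  rw [param, ← (c.mem_frontier_iff hΩ hz).1 h, point_base_height]

end BoundaryChart

/-- A weak form of the isodiametric inequality: in dimension at least two, the Hausdorff measure
normalized by `diam ^ k` is strictly larger than Lebesgue measure. -/
lemma exists_mul_volume_le_hausdorffMeasure {k : ℕ} (hk : 2 ≤ k) :
    ∃ c : ℝ, 1 < c ∧ ∀ s : Set (EuclideanSpace ℝ (Fin k)),
      ENNReal.ofReal c * volume s ≤ μH[(k : ℝ)] s := by
  have hpow : (0 : ℝ) < (1 / 10) ^ k ∧ ((1 : ℝ) / 10) ^ k < 1 :=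
    ⟨by positivity, pow_lt_one₀ (by norm_num) (by norm_num) (by omega)⟩
  have hq : (0 : ℝ) < 1 - (1 / 10) ^ k := by linarith [hpow.2]
  refine ⟨(1 - (1 / 10) ^ k)⁻¹, (one_lt_inv₀ hq).2 (by linarith [hpow.1]), ?_⟩
  suffices h : ENNReal.ofReal (1 - (1 / 10) ^ k)⁻¹ •
      (volume : Measure (EuclideanSpace ℝ (Fin k))) ≤ μH[(k : ℝ)] by
    intro s
    simpa using h s
  refine Measure.le_hausdorffMeasure _ _ 1 one_pos fun s hs => ?_
  have hfin : ediam s ≠ ⊤ := (hs.trans_lt ENNReal.one_lt_top).ne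
  have hbd : Bornology.IsBounded s := isBounded_iff_ediam_ne_top.2 hfin
  set D := diam s with hD
  have hDs : ediam s = ENNReal.ofReal D := (ENNReal.ofReal_toReal hfin).symm
  have hD0 : 0 ≤ D := diam_nonneg
  rw [Measure.smul_apply, smul_eq_mul, ENNReal.rpow_natCast, hDs, ← ENNReal.ofReal_pow hD0]
  rcases s.subsingleton_or_nontrivial with hss | hnt
  · have : Nonempty (Fin k) := ⟨⟨0, by omega⟩⟩
    have : Nontrivial (EuclideanSpace ℝ (Fin k)) := inferInstance
    rw [hss.measure_zero]; simp
  have hDpos : 0 < D := by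
    obtain ⟨x, hx, y, hy, hxy⟩ := hnt
    exact (dist_pos.2 hxy).trans_le (dist_le_diam_of_mem hbd hx hy)
  have hcoord : ∀ x ∈ s, ∀ y ∈ s, ∀ i, x i - y i ≤ D := fun x hx y hy i => by
    have h1 : ‖(x - y) i‖ ≤ ‖x - y‖ := PiLp.norm_apply_le _ _
    rw [← dist_eq_norm] at h1
    exact (le_abs_self _).trans (h1.trans (dist_le_diam_of_mem hbd hx hy))
  obtain ⟨x₀, hx₀⟩ := hnt.nonempty
  set m : Fin k → ℝ := fun i => sInf ((fun x : EuclideanSpace ℝ (Fin k) => x i) '' s) with hm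
  have hlow : ∀ x ∈ s, ∀ i, m i ≤ x i := fun x hx i =>
    csInf_le ⟨x₀ i - D, by rintro _ ⟨y, hy, rfl⟩; linarith [hcoord x₀ hx₀ y hy i]⟩
      (mem_image_of_mem _ hx)
  have hupp : ∀ x ∈ s, ∀ i, x i ≤ m i + D := fun x hx i => by
    have : x i - D ≤ m i := le_csInf (hnt.nonempty.image _) (by
      rintro _ ⟨y, hy, rfl⟩; linarith [hcoord x hx y hy i])
    linarith
  set B : Set (Fin k → ℝ) := Set.pi univ fun i => Icc (m i) (m i + D) with hB
  have key : ∀ u : Fin k → ℝ, (∀ i, m i ≤ u i) → (∀ i, u i + D / 10 ≤ m i + D) →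
      (∀ x ∈ s, ∃ i, x i ∉ Icc (u i) (u i + D / 10)) →
      ENNReal.ofReal (1 - (1 / 10) ^ k)⁻¹ * volume s ≤ ENNReal.ofReal (D ^ k) := by
    intro u hu1 hu2 hu
    set C : Set (Fin k → ℝ) := Set.pi univ fun i => Icc (u i) (u i + D / 10) with hC
    have hCB : C ⊆ B := Set.pi_mono fun i _ => Icc_subset_Icc (hu1 i) (hu2 i)
    have hCm : MeasurableSet C := MeasurableSet.univ_pi fun _ => measurableSet_Icc
    have hBm : MeasurableSet B := MeasurableSet.univ_pi fun _ => measurableSet_Icc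
    have hvC : volume C = ENNReal.ofReal ((D / 10) ^ k) := by
      rw [hC, volume_pi_pi]; simp [← ENNReal.ofReal_pow (by positivity : 0 ≤ D / 10)]
    have hvB : volume B = ENNReal.ofReal (D ^ k) := by
      rw [hB, volume_pi_pi]; simp [← ENNReal.ofReal_pow hD0]
    have hsub : s ⊆ (MeasurableEquiv.toLp 2 (Fin k → ℝ)).symm ⁻¹' (B \ C) := fun x hx =>
      ⟨fun i _ => ⟨hlow x hx i, hupp x hx i⟩, fun h => by
        obtain ⟨i, hi⟩ := hu x hx
        exact hi (h i (mem_univ i))⟩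
    have hvol : volume s ≤ ENNReal.ofReal (D ^ k - (D / 10) ^ k) := by
      refine (measure_mono hsub).trans ?_
      rw [(EuclideanSpace.volume_preserving_symm_measurableEquiv_toLp (Fin k)).measure_preimage
        (hBm.diff hCm).nullMeasurableSet, measure_sdiff hCB hCm.nullMeasurableSet
        (by rw [hvC]; exact ENNReal.ofReal_ne_top), hvB, hvC,
        ENNReal.ofReal_sub _ (by positivity)]
    refine (mul_le_mul_right hvol _).trans ?_
    rw [← ENNReal.ofReal_mul (by positivity)]
    refine ENNReal.ofReal_le_ofReal (le_of_eq ?_)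
    rw [div_eq_mul_one_div D 10, mul_pow]
    field_simp
  by_cases hcor : ∀ x ∈ s, ∃ i, x i ∉ Icc (m i) (m i + D / 10)
  · exact key m (fun i => le_rfl) (fun i => by linarith) hcor
  · push Not at hcor
    obtain ⟨x, hx, hxi⟩ := hcor
    refine key (fun i => m i + D - D / 10) (fun i => by linarith) (fun i => by linarith) ?_
    intro y hy
    by_contra! hyi
    have h1 : dist x y ≤ D := dist_le_diam_of_mem hbd hx hy
    have h2 : ∀ i ∈ Finset.univ, (D * (8 / 10)) ^ 2 ≤ dist (x i) (y i) ^ 2 := fun i _ => by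
      rw [Real.dist_eq, sq_abs]
      have h3 := (hxi i).2
      have h4 := (hyi i).1
      nlinarith
    have h5 := Finset.sum_le_sum h2
    have h6 : dist x y ^ 2 = ∑ i, dist (x i) (y i) ^ 2 := by
      rw [EuclideanSpace.dist_eq, Real.sq_sqrt (Finset.sum_nonneg fun _ _ => sq_nonneg _)]
    rw [← h6] at h5
    simp only [Finset.sum_const, Finset.card_univ, Fintype.card_fin, nsmul_eq_mul] at h5
    have h7 : (2 : ℝ) ≤ k := by exact_mod_cast hk
    have h8 : dist x y ^ 2 ≤ D ^ 2 := pow_le_pow_left₀ dist_nonneg h1 2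
    nlinarith [mul_pos hDpos hDpos, mul_le_mul_of_nonneg_right h7 (sq_nonneg (D * (8 / 10)))]

/-- The linear map of `ℝ^k` stretching in the direction `a` by `√(1 + |a|²)`: it induces the same
metric as the graph of `v ↦ a ⬝ v`. -/
lemma exists_linearMap_graph_metric {k : ℕ} (a : Fin k → ℝ) :
    ∃ S : (Fin k → ℝ) →ₗ[ℝ] (Fin k → ℝ), LinearMap.det S = √(1 + ∑ i, a i ^ 2) ∧
      ∀ v, ∑ i, S v i ^ 2 = ∑ i, v i ^ 2 + (∑ i, a i * v i) ^ 2 := by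
  set J := √(1 + ∑ i, a i ^ 2) with hJ
  have hs : 0 ≤ ∑ i, a i ^ 2 := Finset.sum_nonneg fun _ _ => sq_nonneg _
  have hJ0 : 0 ≤ J := Real.sqrt_nonneg _
  have hJ2 : J ^ 2 = 1 + ∑ i, a i ^ 2 := Real.sq_sqrt (by positivity)
  have hJ1 : J + 1 ≠ 0 := by positivity
  refine ⟨Matrix.toLin' (1 + Matrix.replicateCol Unit (fun i => (J + 1)⁻¹ * a i) *
    Matrix.replicateRow Unit a), ?_, fun v => ?_⟩
  · rw [LinearMap.det_toLin', Matrix.det_one_add_replicateCol_mul_replicateRow]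
    have : a ⬝ᵥ (fun i => (J + 1)⁻¹ * a i) = (J + 1)⁻¹ * ∑ i, a i ^ 2 := by
      rw [dotProduct, Finset.mul_sum]
      exact Finset.sum_congr rfl fun i _ => by ring
    rw [this, show ∑ i, a i ^ 2 = J ^ 2 - 1 by linarith]
    field_simp
    ring
  · set α := ∑ i, a i * v i with hα
    have happ : ∀ i, Matrix.toLin' (1 + Matrix.replicateCol Unit (fun i => (J + 1)⁻¹ * a i) *
        Matrix.replicateRow Unit a) v i = v i + (J + 1)⁻¹ * α * a i := fun i => by
      rw [Matrix.toLin'_apply, Matrix.add_mulVec, Matrix.one_mulVec, Pi.add_apply,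
        ← Matrix.mulVec_mulVec]
      simp [Matrix.mulVec, dotProduct, hα]
      ring
    simp only [happ]
    have : ∀ i, (v i + (J + 1)⁻¹ * α * a i) ^ 2 =
        v i ^ 2 + 2 * (J + 1)⁻¹ * α * (a i * v i) + ((J + 1)⁻¹ * α) ^ 2 * a i ^ 2 := fun i => by
      ring
    simp only [this, Finset.sum_add_distrib, ← Finset.mul_sum]
    rw [← hα, show ∑ i, a i ^ 2 = J ^ 2 - 1 by linarith]
    field_simp
    ring

namespace BoundaryChart

variable {k : ℕ} {Ω : Set (EuclideanSpace ℝ (Fin (k + 1)))} (c : BoundaryChart Ω)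

/-- The gradient of the graph function, coordinate by coordinate. -/
noncomputable def grad (y : Fin k → ℝ) (i : Fin k) : ℝ := fderiv ℝ c.toFun y (Pi.single i 1)

/-- The area element `√(1 + |∇f|²)` of the graph. -/
noncomputable def areaElement (y : Fin k → ℝ) : ℝ := √(1 + ∑ i, c.grad y i ^ 2)

lemma one_le_areaElement (y : Fin k → ℝ) : 1 ≤ c.areaElement y :=
  Real.one_le_sqrt.2 (le_add_of_nonneg_right (Finset.sum_nonneg fun _ _ => sq_nonneg _))

lemma measurableSet_image_param {T : Set (Fin k → ℝ)} (hT : MeasurableSet T) :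
    MeasurableSet (c.param '' T) :=
  (c.continuous_param.measurableEmbedding c.param_injective).measurableSet_image.2 hT

/-- Lower bound for the area of a piece of graph close to a fixed linear graph. -/
lemma area_le_of_approx {C δ : ℝ} (hδ0 : 0 < δ) (hδ1 : δ < 1)
    (hC : ∀ s : Set (EuclideanSpace ℝ (Fin k)), ENNReal.ofReal C * volume s ≤ μH[(k : ℝ)] s)
    (a : Fin k → ℝ) (P : Set (Fin k → ℝ))
    (hP : ∀ y ∈ P, ∀ z ∈ P, |c.toFun y - c.toFun z - ∑ i, a i * (y i - z i)| ≤ δ * dist y z) :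
    ENNReal.ofReal (C * (1 - δ) ^ k) * (ENNReal.ofReal (√(1 + ∑ i, a i ^ 2)) * volume P)
      ≤ μH[(k : ℝ)] (c.param '' P) := by
  obtain ⟨S, hdet, hS⟩ := exists_linearMap_graph_metric a
  set h : EuclideanSpace ℝ (Fin (k + 1)) → EuclideanSpace ℝ (Fin k) :=
    fun z => WithLp.toLp 2 (S (c.base z)) with hh
  have h1δ : 0 < 1 - δ := by linarith
  have hlip : LipschitzOnWith (1 - δ)⁻¹.toNNReal h (c.param '' P) := by
    refine LipschitzOnWith.of_dist_le_mul ?_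
    rintro _ ⟨y, hy, rfl⟩ _ ⟨z, hz, rfl⟩
    rw [Real.coe_toNNReal _ (by positivity), inv_mul_eq_div, le_div_iff₀ h1δ]
    refine le_of_sq_le_sq ?_ dist_nonneg
    rw [mul_pow, c.dist_sq, EuclideanSpace.dist_eq,
      Real.sq_sqrt (Finset.sum_nonneg fun _ _ => sq_nonneg _)]
    have h1 : ∑ i, dist ((h (c.param y)) i) ((h (c.param z)) i) ^ 2 =
        ∑ i, S (y - z) i ^ 2 := by
      refine Finset.sum_congr rfl fun i _ => ?_
      simp [hh, Real.dist_eq, sq_abs]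
    rw [h1, hS]
    simp only [base_param, height_param, Pi.sub_apply]
    have hb := hP y hy z hz
    set V := ∑ i, (y i - z i) ^ 2 with hV
    set α := ∑ i, a i * (y i - z i)
    set b := c.toFun y - c.toFun z
    have hV0 : 0 ≤ V := Finset.sum_nonneg fun _ _ => sq_nonneg _
    have hd : dist y z ≤ √V := by
      refine (dist_pi_le_iff (Real.sqrt_nonneg _)).2 fun i => ?_
      rw [Real.dist_eq]
      exact Real.abs_le_sqrt (Finset.single_le_sum (f := fun i => (y i - z i) ^ 2)
        (fun _ _ => sq_nonneg _) (Finset.mem_univ i))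
    set r := √V
    have hr : r ^ 2 = V := Real.sq_sqrt hV0
    have hr0 : 0 ≤ r := Real.sqrt_nonneg _
    have hb' : |b - α| ≤ δ * r := hb.trans (mul_le_mul_of_nonneg_left hd hδ0.le)
    have h3 : |α| - δ * r ≤ |b| := by
      have := abs_sub_abs_le_abs_sub α b
      rw [abs_sub_comm α b] at this
      linarith
    have h4 : α ^ 2 - 2 * δ * (|α| * r) ≤ b ^ 2 := by
      rw [← sq_abs α, ← sq_abs b]
      by_cases h : |α| ≤ δ * r
      · nlinarith [abs_nonneg α, sq_nonneg |b|, mul_nonneg (abs_nonneg α) (sub_nonneg.2 h),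
          mul_nonneg (abs_nonneg α) (mul_nonneg hδ0.le hr0)]
      · push Not at h
        nlinarith [pow_le_pow_left₀ (sub_nonneg.2 h.le) h3 2, sq_nonneg (δ * r)]
    have h5 : 2 * (|α| * r) ≤ α ^ 2 + V := by
      rw [← sq_abs α, ← hr]; nlinarith [sq_nonneg (|α| - r)]
    nlinarith [mul_le_mul_of_nonneg_left h5 hδ0.le, sq_nonneg α, mul_nonneg hδ0.le hV0,
      mul_nonneg hδ0.le (sq_nonneg α), mul_nonneg (mul_nonneg hδ0.le h1δ.le) hV0,
      mul_nonneg (mul_nonneg hδ0.le h1δ.le) (sq_nonneg α)]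
  have himg : h '' (c.param '' P) = (MeasurableEquiv.toLp 2 (Fin k → ℝ)).symm ⁻¹' (S '' P) := by
    ext w
    simp only [hh, mem_image, exists_exists_and_eq_and, base_param, mem_preimage,
      MeasurableEquiv.coe_toLp_symm]
    constructor
    · rintro ⟨y, hy, rfl⟩; exact ⟨y, hy, rfl⟩
    · rintro ⟨y, hy, e⟩; exact ⟨y, hy, by rw [e]⟩
  have hvol : volume (h '' (c.param '' P)) =
      ENNReal.ofReal (√(1 + ∑ i, a i ^ 2)) * volume P := by
    rw [himg, (EuclideanSpace.volume_preserving_symm_measurableEquiv_toLp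
      (Fin k)).measure_preimage_equiv, Measure.addHaar_image_linearMap, hdet,
      abs_of_nonneg (Real.sqrt_nonneg _)]
  have h1 := hC (h '' (c.param '' P))
  have h2 := hlip.hausdorffMeasure_image_le (d := k) (Nat.cast_nonneg k)
  rw [hvol] at h1
  have h3 := h1.trans h2
  have hδk : 0 < (1 - δ) ^ k := by positivity
  calc ENNReal.ofReal (C * (1 - δ) ^ k) * (ENNReal.ofReal (√(1 + ∑ i, a i ^ 2)) * volume P)
      = ENNReal.ofReal ((1 - δ) ^ k) *
        (ENNReal.ofReal C * (ENNReal.ofReal (√(1 + ∑ i, a i ^ 2)) * volume P)) := by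
        rw [mul_comm C, ENNReal.ofReal_mul hδk.le, mul_assoc]
    _ ≤ ENNReal.ofReal ((1 - δ) ^ k) * _ := mul_le_mul_right h3 _
    _ = μH[(k : ℝ)] (c.param '' P) := by
        rw [← mul_assoc, ENNReal.rpow_natCast,
          show (((1 - δ)⁻¹.toNNReal : NNReal) : ENNReal) = ENNReal.ofReal (1 - δ)⁻¹ from rfl,
          ← ENNReal.ofReal_pow (by positivity), ← ENNReal.ofReal_mul hδk.le, inv_pow,
          mul_inv_cancel₀ hδk.ne', ENNReal.ofReal_one, one_mul]

/-- Lower area bound for Lipschitz graphs. -/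
lemma lintegral_areaElement_le {C δ : ℝ} (hk : 0 < k) (hδ0 : 0 < δ) (hδ1 : δ < 1)
    (hC : ∀ s : Set (EuclideanSpace ℝ (Fin k)), ENNReal.ofReal C * volume s ≤ μH[(k : ℝ)] s)
    {T : Set (Fin k → ℝ)} (hT : MeasurableSet T) :
    ENNReal.ofReal (C * (1 - δ) ^ k / (1 + k * δ)) *
      ∫⁻ y in T, ENNReal.ofReal (c.areaElement y) ≤ μH[(k : ℝ)] (c.param '' T) := by
  have : Nonempty (Fin k) := ⟨⟨0, hk⟩⟩
  let i₀ : Fin k := ⟨0, hk⟩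
  have hk1 : (1 : ℝ) ≤ k := by exact_mod_cast hk
  set D := {y | DifferentiableAt ℝ c.toFun y} with hD
  have hDm : MeasurableSet D := measurableSet_of_differentiableAt ℝ c.toFun
  have hDae : ∀ᵐ y, y ∈ D := c.lip.ae_differentiableAt
  let F : (Fin k → ℝ) → (Fin k → ℝ) := fun y _ => c.toFun y
  let F' : (Fin k → ℝ) → (Fin k → ℝ) →L[ℝ] (Fin k → ℝ) :=
    fun y => ContinuousLinearMap.pi fun _ => fderiv ℝ c.toFun y
  have hF' : ∀ y ∈ T ∩ D, HasFDerivWithinAt F (F' y) (T ∩ D) y := fun y hy =>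
    (hasFDerivAt_pi.2 fun _ => hy.2.hasFDerivAt).hasFDerivWithinAt
  obtain ⟨t, A, htd, htm, htc, htA, -⟩ := exists_partition_approximatesLinearOn_of_hasFDerivWithinAt
    F (T ∩ D) F' hF' (fun _ => δ.toNNReal) (fun _ => by simpa using hδ0)
  set P : ℕ → Set (Fin k → ℝ) := fun n => T ∩ D ∩ t n with hPdef
  have hPm : ∀ n, MeasurableSet (P n) := fun n => (hT.inter hDm).inter (htm n)
  have hPd : Pairwise (Function.onFun Disjoint P) := fun m n hmn =>
    (htd hmn).mono inter_subset_right inter_subset_right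
  have hPT : (⋃ n, P n) = T ∩ D := by
    rw [← inter_iUnion, inter_eq_left]; exact htc
  let a : ℕ → Fin k → ℝ := fun n i => A n (Pi.single i 1) i₀
  have hAa : ∀ n v, A n v i₀ = ∑ i, a n i * v i := fun n v => by
    have := congrFun ((A n).toLinearMap.pi_apply_eq_sum_univ v) i₀
    simp only [ContinuousLinearMap.coe_coe, Finset.sum_apply, Pi.smul_apply, smul_eq_mul] at this
    rw [this]
    refine Finset.sum_congr rfl fun i _ => ?_
    have e : (fun j => if i = j then (1 : ℝ) else 0) = Pi.single i 1 := by
      ext j; simp [Pi.single_apply, eq_comm]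
    rw [e, mul_comm]
  have hpiece : ∀ n, ENNReal.ofReal (C * (1 - δ) ^ k / (1 + k * δ)) *
      ∫⁻ y in P n, ENNReal.ofReal (c.areaElement y) ≤ μH[(k : ℝ)] (c.param '' P n) := by
    intro n
    have happ : ∀ y ∈ P n, ∀ z ∈ P n,
        |c.toFun y - c.toFun z - ∑ i, a n i * (y i - z i)| ≤ δ * dist y z := fun y hy z hz => by
      have h1 := htA n y hy z hz
      rw [Real.coe_toNNReal _ hδ0.le, ← dist_eq_norm y z] at h1
      have h2 := (norm_le_pi_norm (F y - F z - A n (y - z)) i₀).trans h1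
      rw [Pi.sub_apply, hAa, Real.norm_eq_abs] at h2
      exact h2
    refine le_trans ?_ (c.area_le_of_approx hδ0 hδ1 hC (a n) (P n) happ)
    have hder := (htA n).norm_fderiv_sub_le volume (hPm n) F'
      (fun y hy => (hF' y hy.1).mono inter_subset_left)
    have hbound : ∀ᵐ y ∂volume.restrict (P n), ENNReal.ofReal (c.areaElement y) ≤
        ENNReal.ofReal ((1 + k * δ) * √(1 + ∑ i, a n i ^ 2)) := by
      filter_upwards [hder] with y hy
      refine ENNReal.ofReal_le_ofReal ?_
      have hy' : ‖F' y - A n‖ ≤ δ := by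
        have : ((‖F' y - A n‖₊ : NNReal) : ℝ) ≤ (δ.toNNReal : ℝ) := hy
        rwa [Real.coe_toNNReal _ hδ0.le, coe_nnnorm] at this
      have hcomp : ∀ i, |c.grad y i - a n i| ≤ δ := fun i => by
        have h1 := (F' y - A n).le_opNorm (Pi.single i 1)
        have h2 := norm_le_pi_norm ((F' y - A n) (Pi.single i 1)) i₀
        have h3 : ‖(Pi.single i 1 : Fin k → ℝ)‖ = 1 := by rw [Pi.norm_single]; simp
        rw [h3, mul_one] at h1
        exact (h2.trans h1).trans hy'
      have hsq : ∀ i ∈ Finset.univ,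
          c.grad y i ^ 2 ≤ (1 + δ) * a n i ^ 2 + (δ + δ ^ 2) := fun i _ => by
        have h1 := abs_le.1 (hcomp i)
        set e := c.grad y i - a n i with he
        rw [show c.grad y i = a n i + e by rw [he]; ring]
        have h2 : 2 * (a n i * e) ≤ δ * (a n i ^ 2 + 1) := by
          have : |2 * (a n i * e)| ≤ δ * (a n i ^ 2 + 1) := by
            rw [abs_mul, abs_mul, abs_two, ← sq_abs (a n i)]
            nlinarith [hcomp i, abs_nonneg (a n i), sq_nonneg (|a n i| - 1),
              mul_le_mul_of_nonneg_left (hcomp i) (abs_nonneg (a n i))]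
          exact (le_abs_self _).trans this
        nlinarith
      have hsum := Finset.sum_le_sum hsq
      rw [Finset.sum_add_distrib, ← Finset.mul_sum] at hsum
      simp only [Finset.sum_const, Finset.card_univ, Fintype.card_fin, nsmul_eq_mul] at hsum
      set Q := ∑ i, a n i ^ 2
      have hQ : 0 ≤ Q := Finset.sum_nonneg fun _ _ => sq_nonneg _
      refine Real.sqrt_le_iff.2 ⟨by positivity, ?_⟩
      rw [mul_pow, Real.sq_sqrt (by positivity)]
      have hkδ : 0 ≤ (k : ℝ) * δ := by positivity
      have h6 : δ ≤ k * δ := le_mul_of_one_le_left hδ0.le hk1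
      have h7 : (k : ℝ) * δ ^ 2 ≤ (k * δ) ^ 2 := by
        nlinarith [sq_nonneg δ, mul_nonneg (mul_nonneg (Nat.cast_nonneg k) (sub_nonneg.2 hk1))
          (sq_nonneg δ)]
      nlinarith [mul_nonneg hkδ hQ, mul_nonneg (sq_nonneg (k * δ)) hQ,
        mul_nonneg (sub_nonneg.2 h6) hQ]
    have h8 : ∫⁻ y in P n, ENNReal.ofReal (c.areaElement y) ≤
        ENNReal.ofReal ((1 + k * δ) * √(1 + ∑ i, a n i ^ 2)) * volume (P n) := by
      refine (lintegral_mono_ae hbound).trans ?_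
      simp
    refine (mul_le_mul_right h8 _).trans (le_of_eq ?_)
    have hpos : 0 < 1 + k * δ := by positivity
    rw [ENNReal.ofReal_mul hpos.le, ← mul_assoc, ← mul_assoc, ← mul_assoc,
      ← ENNReal.ofReal_mul' hpos.le, div_mul_cancel₀ _ hpos.ne']
  have hTae : ∫⁻ y in T, ENNReal.ofReal (c.areaElement y) =
      ∑' n, ∫⁻ y in P n, ENNReal.ofReal (c.areaElement y) := by
    rw [← lintegral_iUnion hPm hPd, hPT]
    refine setLIntegral_congr ?_
    filter_upwards [hDae] with y hy
    exact propext ⟨fun h => ⟨h, hy⟩, fun h => h.1⟩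
  rw [hTae, ← ENNReal.tsum_mul_left]
  refine (ENNReal.tsum_le_tsum hpiece).trans ?_
  refine (tsum_meas_le_meas_iUnion_of_disjoint _
    (fun n => c.measurableSet_image_param (hPm n))
    (fun m n hmn => (disjoint_image_iff c.param_injective).2 (hPd hmn))).trans ?_
  rw [← image_iUnion, hPT]
  exact measure_mono (image_mono inter_subset_left)

/-- In dimension `k ≥ 2` the Hausdorff measure of a graph exceeds its area by a fixed factor. -/
lemma exists_mul_lintegral_areaElement_le (hk : 2 ≤ k) :
    ∃ θ : ℝ, 1 < θ ∧ ∀ (Ω : Set (EuclideanSpace ℝ (Fin (k + 1)))) (c : BoundaryChart Ω)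
      (T : Set (Fin k → ℝ)), MeasurableSet T → ENNReal.ofReal θ *
        ∫⁻ y in T, ENNReal.ofReal (c.areaElement y) ≤ μH[(k : ℝ)] (c.param '' T) := by
  obtain ⟨C, hC1, hC⟩ := exists_mul_volume_le_hausdorffMeasure hk
  have hlim : Tendsto (fun δ : ℝ => C * (1 - δ) ^ k / (1 + k * δ)) (𝓝 0) (𝓝 C) := by
    have : ContinuousAt (fun δ : ℝ => C * (1 - δ) ^ k / (1 + k * δ)) 0 := by
      refine ContinuousAt.div (by fun_prop) (by fun_prop) (by simp)
    simpa [ContinuousAt] using this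
  have hev : ∀ᶠ δ : ℝ in 𝓝[>] 0, 1 < C * (1 - δ) ^ k / (1 + k * δ) ∧ δ < 1 ∧ 0 < δ := by
    filter_upwards [nhdsWithin_le_nhds (hlim.eventually_const_lt hC1),
      nhdsWithin_le_nhds (eventually_lt_nhds (zero_lt_one' ℝ)), self_mem_nhdsWithin]
      with δ h1 h2 h3 using ⟨h1, h2, h3⟩
  obtain ⟨δ, h1, h2, h3⟩ := hev.exists
  exact ⟨_, h1, fun Ω c T hT => c.lintegral_areaElement_le (by omega) h3 h2 hC hT⟩

end BoundaryChart

section Decomposition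

variable {k : ℕ} {Ω : Set (EuclideanSpace ℝ (Fin (k + 1)))}

lemma hausdorffMeasure_frontier_lt_top (hΩ : IsOpen Ω) (hΩb : Bornology.IsBounded Ω)
    (hch : ∀ x ∈ frontier Ω, ∃ c : BoundaryChart Ω, c.center = x ∧ 0 < c.radius) :
    μH[(k : ℝ)] (frontier Ω) < ⊤ := by
  have hcpt : IsCompact (frontier Ω) :=
    isCompact_of_isClosed_isBounded isClosed_frontier (hΩb.closure.subset frontier_subset_closure)
  refine hcpt.measure_lt_top_of_nhdsWithin fun x hx => ?_
  obtain ⟨c, rfl, hr⟩ := hch x hx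
  refine ⟨frontier Ω ∩ ball c.center c.radius, ?_, ?_⟩
  · exact inter_mem_nhdsWithin _ (ball_mem_nhds _ hr)
  · obtain ⟨K, hK⟩ := c.exists_lipschitzWith_param
    have hsub : frontier Ω ∩ ball c.center c.radius ⊆
        c.param '' ball (c.base c.center) c.radius := fun z hz =>
      ⟨c.base z, (c.dist_base_le _ _).trans_lt hz.2, c.param_base hΩ hz.1 hz.2⟩
    refine (measure_mono hsub).trans_lt ?_
    refine ((hK.lipschitzOnWith (s := ball (c.base c.center) c.radius)).hausdorffMeasure_image_le
      (d := k) (Nat.cast_nonneg k)).trans_lt ?_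
    have h1 : (μH[(k : ℝ)] : Measure (Fin k → ℝ)) = volume := by
      simpa using hausdorffMeasure_pi_real (ι := Fin k)
    rw [h1]
    exact ENNReal.mul_lt_top (by simp) measure_ball_lt_top

/-- The boundary is covered by finitely many charts, cut into pieces that overlap in a null set
only. -/
lemma exists_boundary_decomposition (hΩ : IsOpen Ω) (hΩb : Bornology.IsBounded Ω)
    (hch : ∀ x ∈ frontier Ω, ∃ c : BoundaryChart Ω, c.center = x ∧ 0 < c.radius) :
    ∃ (n : ℕ) (c : Fin n → BoundaryChart Ω) (r : Fin n → ℝ)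
      (K D : Fin n → Set (EuclideanSpace ℝ (Fin (k + 1)))),
      (∀ j, r j < (c j).radius) ∧ (frontier Ω ⊆ ⋃ j, ball (c j).center (r j)) ∧
      (∀ j, IsClosed (K j)) ∧ (∀ j, K j ⊆ closedBall (c j).center (r j)) ∧
      ((⋃ j, ball (c j).center (r j)) ⊆ ⋃ j, K j) ∧
      (∀ j, IsOpen (D j)) ∧ (∀ j, D j ⊆ K j) ∧ Pairwise (Function.onFun Disjoint D) ∧
      ∀ j, μH[(k : ℝ)] (frontier Ω ∩ (K j \ D j)) = 0 := by
  have hfin := hausdorffMeasure_frontier_lt_top hΩ hΩb hch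
  have hcpt : IsCompact (frontier Ω) :=
    isCompact_of_isClosed_isBounded isClosed_frontier (hΩb.closure.subset frontier_subset_closure)
  set μ := (μH[(k : ℝ)] : Measure (EuclideanSpace ℝ (Fin (k + 1)))).restrict (frontier Ω) with hμ
  have : IsFiniteMeasure μ := ⟨by simpa [hμ] using hfin⟩
  have hx : ∀ x : frontier Ω, ∃ (c : BoundaryChart Ω) (r : ℝ), c.center = x ∧ 0 < r ∧
      r < c.radius ∧ μ (sphere c.center r) = 0 := fun x => by
    obtain ⟨c, hc, hr⟩ := hch x x.2
    obtain ⟨r, hr1, hr2⟩ := exists_null_frontier_thickening μ {c.center} hr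
    rw [thickening_singleton, frontier_ball _ hr1.1.ne'] at hr2
    exact ⟨c, r, hc, hr1.1, hr1.2, hr2⟩
  choose c r hc hr0 hr1 hr2 using hx
  obtain ⟨t, ht⟩ := hcpt.elim_finite_subcover (fun x : frontier Ω => ball (c x).center (r x))
    (fun _ => isOpen_ball) fun x hx => mem_iUnion.2 ⟨⟨x, hx⟩, by
      rw [hc]; exact mem_ball_self (hr0 _)⟩
  let e : Fin t.card → frontier Ω := fun j => (t.equivFin.symm j : frontier Ω)
  have hcov : frontier Ω ⊆ ⋃ j, ball (c (e j)).center (r (e j)) := fun x hx => by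
    obtain ⟨i, hi, hxi⟩ := mem_iUnion₂.1 (ht hx)
    exact mem_iUnion.2 ⟨t.equivFin ⟨i, hi⟩, by simpa [e] using hxi⟩
  refine ⟨t.card, fun j => c (e j), fun j => r (e j),
    fun j => closedBall (c (e j)).center (r (e j)) \ ⋃ i, ⋃ (_ : i < j),
      ball (c (e i)).center (r (e i)),
    fun j => ball (c (e j)).center (r (e j)) \ ⋃ i, ⋃ (_ : i < j),
      closedBall (c (e i)).center (r (e i)), fun j => hr1 _, hcov, ?_, ?_, ?_, ?_, ?_, ?_, ?_⟩
  · exact fun j => isClosed_closedBall.sdiff (isOpen_iUnion fun i => isOpen_iUnion fun _ =>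
      isOpen_ball)
  · exact fun j => sdiff_subset
  · intro x hx
    have hex : ∃ j, x ∈ ball (c (e j)).center (r (e j)) := mem_iUnion.1 hx
    obtain ⟨j, hj, hmin⟩ := WellFounded.has_min (wellFounded_lt (α := Fin t.card))
      {j | x ∈ ball (c (e j)).center (r (e j))} hex
    refine mem_iUnion.2 ⟨j, ball_subset_closedBall hj, fun h => ?_⟩
    obtain ⟨i, hij, hi⟩ := mem_iUnion₂.1 h
    exact hmin i hi hij
  · exact fun j => isOpen_ball.sdiff (isClosed_iUnion_of_finite fun i =>
      isClosed_iUnion_of_finite fun _ => isClosed_closedBall)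
  · exact fun j => sdiff_subset_sdiff ball_subset_closedBall
      (iUnion₂_mono fun _ _ => ball_subset_closedBall)
  · have key : ∀ i j : Fin t.card, i < j → Disjoint
        (ball (c (e i)).center (r (e i)) \ ⋃ l, ⋃ (_ : l < i), closedBall (c (e l)).center (r (e l)))
        (ball (c (e j)).center (r (e j)) \ ⋃ l, ⋃ (_ : l < j),
          closedBall (c (e l)).center (r (e l))) := fun i j hij =>
      disjoint_left.2 fun x hx hx' => hx'.2 (mem_iUnion₂.2 ⟨i, hij, ball_subset_closedBall hx.1⟩)
    intro i j hij
    rcases lt_or_gt_of_ne hij with h | h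
    · exact key i j h
    · exact (key j i h).symm
  · intro j
    refine measure_mono_null (t := ⋃ i, frontier Ω ∩ sphere (c (e i)).center (r (e i))) ?_
      (measure_iUnion_null fun i => ?_)
    · rintro x ⟨hx, ⟨hx1, hx2⟩, hx3⟩
      rw [← inter_iUnion]
      refine ⟨hx, ?_⟩
      by_contra hs
      simp only [mem_iUnion, not_exists, mem_sphere] at hs
      simp only [mem_iUnion, not_exists, mem_ball] at hx2
      refine hx3 ⟨lt_of_le_of_ne hx1 (hs j), fun h => ?_⟩
      obtain ⟨i, hij, hi⟩ := mem_iUnion₂.1 h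
      exact hx2 i hij (lt_of_le_of_ne hi (hs i))
    · have := hr2 (e i)
      rwa [hμ, Measure.restrict_apply isClosed_sphere.measurableSet, inter_comm] at this

end Decomposition

namespace BoundaryChart

variable {k : ℕ} {Ω : Set (EuclideanSpace ℝ (Fin (k + 1)))} (c : BoundaryChart Ω)

lemma exists_near_graph (hΩ : IsOpen Ω) {r ε : ℝ} (hε : r + ε ≤ c.radius)
    {x : EuclideanSpace ℝ (Fin (k + 1))} (hx : x ∈ closedBall c.center r)
    (hx' : x ∈ thickening ε (frontier Ω)) :
    ∃ w : Fin k → ℝ, dist x (c.param w) < ε := by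
  obtain ⟨z, hz, hxz⟩ := mem_thickening_iff.1 hx'
  refine ⟨c.base z, ?_⟩
  rwa [c.param_base hΩ hz]
  rw [mem_closedBall] at hx
  rw [dist_comm] at hxz
  rw [mem_ball]
  linarith [dist_triangle z x c.center]

lemma abs_height_sub_le_of_near {ε : ℝ} {x : EuclideanSpace ℝ (Fin (k + 1))} {w : Fin k → ℝ}
    (hw : dist x (c.param w) < ε) : |c.height x - c.toFun (c.base x)| ≤ (1 + c.const) * ε := by
  have h1 := c.abs_height_sub_le x (c.param w)
  have h2 := c.dist_base_le (c.param w) x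
  have h3 := c.lip.dist_le_mul w (c.base x)
  rw [height_param] at h1
  rw [base_param, dist_comm (c.param w)] at h2
  rw [Real.dist_eq] at h3
  have h4 : (c.const : ℝ) * dist w (c.base x) ≤ c.const * ε := by
    gcongr; exact h2.trans hw.le
  calc _ = |(c.height x - c.toFun w) + (c.toFun w - c.toFun (c.base x))| := by ring_nf
    _ ≤ _ := abs_add_le _ _
    _ ≤ _ := by linarith

lemma abs_height_sub_le_of_near_of_differentiableAt {y : Fin k → ℝ}
    (hy : DifferentiableAt ℝ c.toFun y) {η : ℝ} (hη : 0 < η) :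
    ∃ δ > 0, ∀ ε < δ, ∀ x w, c.base x = y → dist x (c.param w) < ε →
      |c.height x - c.toFun y| ≤ ε * (c.areaElement y + η) := by
  have h := hy.hasFDerivAt.isLittleO.def hη
  obtain ⟨δ, hδ, hδ'⟩ := Metric.eventually_nhds_iff.1 h
  refine ⟨δ, hδ, fun ε hε x w hxy hw => ?_⟩
  have hε0 : 0 < ε := dist_nonneg.trans_lt hw
  have h2 := c.dist_base_le (c.param w) x
  rw [base_param, dist_comm (c.param w), hxy] at h2
  have h3 := hδ' (h2.trans_lt (hw.trans hε))
  rw [Real.norm_eq_abs, ← dist_eq_norm] at h3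
  have h4 : fderiv ℝ c.toFun y (w - y) = ∑ i, c.grad y i * (w i - y i) := by
    conv_lhs => rw [pi_eq_sum_univ' (w - y), map_sum]
    refine Finset.sum_congr rfl fun i _ => ?_
    rw [map_smul, smul_eq_mul, mul_comm, grad]
    rfl
  rw [h4] at h3
  set s := c.height x - c.toFun w
  set α := ∑ i, c.grad y i * (w i - y i)
  have hd := c.dist_sq x (c.param w)
  rw [hxy, base_param, height_param] at hd
  have hCS : α ^ 2 ≤ (∑ i, c.grad y i ^ 2) * ∑ i, (w i - y i) ^ 2 :=
    Finset.sum_mul_sq_le_sq_mul_sq _ _ _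
  have hsw : ∑ i, (w i - y i) ^ 2 = ∑ i, (y i - w i) ^ 2 :=
    Finset.sum_congr rfl fun i _ => by ring
  rw [hsw] at hCS
  set G := ∑ i, c.grad y i ^ 2
  set V := ∑ i, (y i - w i) ^ 2
  have hG : 0 ≤ G := Finset.sum_nonneg fun _ _ => sq_nonneg _
  have hV : 0 ≤ V := Finset.sum_nonneg fun _ _ => sq_nonneg _
  have hA : c.areaElement y ^ 2 = 1 + G := Real.sq_sqrt (by positivity)
  have h5 : (|s| + |α|) ^ 2 ≤ (ε * c.areaElement y) ^ 2 := by
    have h6 : (|s| + |α|) ^ 2 ≤ (1 + G) * (s ^ 2 + V) := by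
      rcases eq_or_lt_of_le hG with h0 | h0
      · rw [← h0, zero_mul] at hCS
        have : α = 0 := by nlinarith
        rw [← h0, this]
        simp; exact hV
      · have h7 : (2 * |s| * |α|) ≤ G * s ^ 2 + V := by
          have : (2 * |s| * |α|) * G ≤ (G * s ^ 2 + V) * G := by
            rw [← sq_abs s]
            rw [← sq_abs α] at hCS
            nlinarith [sq_nonneg (G * |s| - |α|)]
          exact le_of_mul_le_mul_right this h0
        nlinarith [sq_abs s, sq_abs α]
    have h8 : dist x (c.param w) ^ 2 ≤ ε ^ 2 := by gcongr
    rw [mul_pow, hA]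
    nlinarith
  have h6 : |s| + |α| ≤ ε * c.areaElement y :=
    (abs_le_of_sq_le_sq h5 (by have := c.one_le_areaElement y; positivity)).trans' (le_abs_self _)
  have h7 : η * dist w y ≤ η * ε := by gcongr; exact h2.trans hw.le
  calc |c.height x - c.toFun y| = |s + α + (c.toFun w - c.toFun y - α)| := by
        congr 1; simp only [s]; ring
    _ ≤ |s| + |α| + |c.toFun w - c.toFun y - α| := abs_add_three _ _ _
    _ ≤ _ := by linarith

/-- Upper bound for the Minkowski content of a piece of the boundary. -/
lemma limsup_volume_thickening_le (hΩ : IsOpen Ω) {K : Set (EuclideanSpace ℝ (Fin (k + 1)))}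
    (hK : IsClosed K) {r : ℝ} (hKr : K ⊆ closedBall c.center r) {ε : ℕ → ℝ} (hε0 : ∀ n, 0 < ε n)
    (hε : Tendsto ε atTop (𝓝 0)) (hεr : ∀ n, r + ε n ≤ c.radius) :
    limsup (fun n => volume (K ∩ thickening (ε n) (frontier Ω)) / ENNReal.ofReal (2 * ε n)) atTop
      ≤ ∫⁻ y in c.param ⁻¹' K, ENNReal.ofReal (c.areaElement y) := by
  set N : ℕ → Set (EuclideanSpace ℝ (Fin (k + 1))) :=
    fun n => K ∩ thickening (ε n) (frontier Ω) with hN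
  have hNm : ∀ n, MeasurableSet (N n) := fun n =>
    hK.measurableSet.inter isOpen_thickening.measurableSet
  set F : ℕ → (Fin k → ℝ) → ENNReal :=
    fun n y => volume {τ | c.point y τ ∈ N n} / ENNReal.ofReal (2 * ε n) with hF
  have hFm : ∀ n, Measurable (F n) := fun n =>
    (volume_eq_lintegral_slices c.rot (hNm n)).1.div_const _
  have hvol : ∀ n, volume (N n) / ENNReal.ofReal (2 * ε n) = ∫⁻ y, F n y := fun n => by
    have hm : Measurable fun y => volume {τ | c.point y τ ∈ N n} :=
      (volume_eq_lintegral_slices c.rot (hNm n)).1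
    simp only [hF, div_eq_mul_inv]
    rw [lintegral_mul_const _ hm,
      (volume_eq_lintegral_slices c.rot (hNm n)).2]
    rfl
  have hslice : ∀ n y B, (∀ τ, c.point y τ ∈ N n → |τ - c.toFun y| ≤ ε n * B) →
      F n y ≤ ENNReal.ofReal B := fun n y B h => by
    refine ENNReal.div_le_of_le_mul ?_
    have hsub : {τ | c.point y τ ∈ N n} ⊆ closedBall (c.toFun y) (ε n * B) := h
    refine (measure_mono hsub).trans ?_
    rw [Real.volume_closedBall]
    rw [← ENNReal.ofReal_mul' (mul_pos two_pos (hε0 n)).le]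
    exact (congrArg _ (by ring)).le
  have hnear : ∀ n y τ, c.point y τ ∈ N n → ∃ w, dist (c.point y τ) (c.param w) < ε n :=
    fun n y τ h => c.exists_near_graph hΩ (hεr n) (hKr h.1) h.2
  have hbd : ∀ n y, F n y ≤
      (closedBall (c.base c.center) r).indicator (fun _ => ENNReal.ofReal (1 + c.const)) y := by
    intro n y
    by_cases hy : y ∈ closedBall (c.base c.center) r
    · rw [indicator_of_mem hy]
      refine hslice n y _ fun τ h => ?_
      obtain ⟨w, hw⟩ := hnear n y τ h
      simpa [mul_comm] using c.abs_height_sub_le_of_near hw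
    · have : {τ | c.point y τ ∈ N n} = ∅ := eq_empty_of_forall_notMem fun τ h => hy <| by
        simpa using (c.dist_base_le _ _).trans (mem_closedBall.1 (hKr h.1))
      simp [hF, this]
  have key := limsup_lintegral_le (μ := volume)
    ((closedBall (c.base c.center) r).indicator (fun _ => ENNReal.ofReal (1 + c.const)))
    hFm (fun n => ae_of_all _ (hbd n)) (by
      rw [lintegral_indicator_const measurableSet_closedBall]
      exact (ENNReal.mul_lt_top (by simp) measure_closedBall_lt_top).ne)
  simp only [hN] at hvol
  simp only [hvol]
  refine key.trans ?_
  rw [← lintegral_indicator (c.continuous_param.measurable hK.measurableSet)]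
  refine lintegral_mono_ae ?_
  filter_upwards [c.lip.ae_differentiableAt (μ := volume)] with y hy
  by_cases hyK : y ∈ c.param ⁻¹' K
  · rw [indicator_of_mem hyK]
    refine ENNReal.le_of_forall_pos_le_add fun η hη _ => ?_
    obtain ⟨δ, hδ, hδ'⟩ := c.abs_height_sub_le_of_near_of_differentiableAt hy hη
    rw [← ENNReal.ofReal_coe_nnreal, ← ENNReal.ofReal_add
      (zero_le_one.trans (c.one_le_areaElement y)) η.coe_nonneg]
    refine limsup_le_of_le (by isBoundedDefault) ?_
    filter_upwards [hε.eventually_lt_const hδ] with n hn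
    refine hslice n y _ fun τ h => ?_
    obtain ⟨w, hw⟩ := hnear n y τ h
    simpa using hδ' _ hn _ w (c.base_point y τ) hw
  · rw [indicator_of_notMem hyK]
    refine limsup_le_of_le (by isBoundedDefault) ?_
    obtain ⟨ρ, hρ, hρ'⟩ := Metric.isOpen_iff.1 hK.isOpen_compl _ hyK
    have hlim : Tendsto (fun n => (1 + c.const) * ε n) atTop (𝓝 0) := by
      simpa using hε.const_mul (1 + (c.const : ℝ))
    filter_upwards [hlim.eventually_lt_const hρ] with n hn
    have : {τ | c.point y τ ∈ N n} = ∅ := eq_empty_of_forall_notMem fun τ h => by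
      obtain ⟨w, hw⟩ := hnear n y τ h
      have h2 := c.abs_height_sub_le_of_near hw
      rw [base_point, ← height_param, c.height_point] at h2
      refine hρ' (a := c.point y τ) ?_ h.1
      rw [mem_ball, param, c.dist_point_vertical]
      rw [height_param] at h2
      exact h2.trans_lt hn
    simp [hF, this]

end BoundaryChart

section HigherDimension

variable {k : ℕ} {Ω : Set (EuclideanSpace ℝ (Fin (k + 1)))}

lemma isCompact_frontier_of_isBounded (hΩb : Bornology.IsBounded Ω) : IsCompact (frontier Ω) :=
  isCompact_of_isClosed_isBounded isClosed_frontier (hΩb.closure.subset frontier_subset_closure)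

/-- A tube around the boundary that is small compared with all the charts of a finite cover. -/
lemma exists_uniform_tube (hΩb : Bornology.IsBounded Ω) {n : ℕ} (c : Fin n → BoundaryChart Ω)
    (r : Fin n → ℝ) (hr : ∀ j, r j < (c j).radius)
    (hcov : frontier Ω ⊆ ⋃ j, ball (c j).center (r j)) :
    ∃ ε₁ : ℝ, 0 < ε₁ ∧ (∀ j, r j + ε₁ ≤ (c j).radius) ∧
      thickening ε₁ (frontier Ω) ⊆ ⋃ j, ball (c j).center (r j) := by
  obtain ⟨δ, hδ, hδ'⟩ := (isCompact_frontier_of_isBounded hΩb).exists_thickening_subset_open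
    (isOpen_iUnion fun _ => isOpen_ball) hcov
  have : ∀ᶠ ε in 𝓝[>] (0 : ℝ), ∀ j, ε < (c j).radius - r j := eventually_all.2 fun j =>
    nhdsWithin_le_nhds (eventually_lt_nhds (sub_pos.2 (hr j)))
  obtain ⟨ε, hε, hε1, hε2⟩ := (this.and (Ioo_mem_nhdsGT hδ)).exists
  exact ⟨ε, hε1, fun j => by linarith [hε j], (thickening_mono hε2.le _).trans hδ'⟩

lemma exists_volume_thickening_le_of_two_le (hk : 2 ≤ k) (hΩ : IsOpen Ω)
    (hΩb : Bornology.IsBounded Ω)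
    (hch : ∀ x ∈ frontier Ω, ∃ c : BoundaryChart Ω, c.center = x ∧ 0 < c.radius) :
    ∃ ε₀ : ℝ, 0 < ε₀ ∧ ∀ ε : ℝ, 0 < ε → ε < ε₀ →
      volume (thickening ε (frontier Ω)) ≤ ENNReal.ofReal (2 * ε) * μH[(k : ℝ)] (frontier Ω) := by
  rcases (frontier Ω).eq_empty_or_nonempty with hemp | ⟨x₀, hx₀⟩
  · exact ⟨1, one_pos, fun ε _ _ => by simp [hemp]⟩
  by_contra! hcon
  set H := μH[(k : ℝ)] (frontier Ω)
  have hHfin : H < ⊤ := hausdorffMeasure_frontier_lt_top hΩ hΩb hch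
  obtain ⟨n, c, r, K, D, hr, hcov, hK, hKr, hKcov, hD, hDK, hDD, hnull⟩ :=
    exists_boundary_decomposition hΩ hΩb hch
  obtain ⟨ε₁, hε₁, hε₁r, hε₁c⟩ := exists_uniform_tube hΩb c r hr hcov
  obtain ⟨θ, hθ, hθ'⟩ := BoundaryChart.exists_mul_lintegral_areaElement_le hk
  have hsub : ∀ j, (c j).param '' ((c j).param ⁻¹' K j) ⊆ frontier Ω ∩ K j := by
    rintro j _ ⟨y, hy, rfl⟩
    exact ⟨(c j).param_mem_frontier hΩ (closedBall_subset_ball (hr j) (hKr j hy)), hy⟩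
  choose! ε hε0 hεlt hviol using fun m : ℕ => hcon (min ε₁ (1 / (m + 1))) (by positivity)
  have hεlim : Tendsto ε atTop (𝓝 0) :=
    squeeze_zero (fun m => (hε0 m).le) (fun m => ((hεlt m).trans_le (min_le_right _ _)).le)
      tendsto_one_div_add_atTop_nhds_zero_nat
  have hε1 : ∀ m, ε m < ε₁ := fun m => (hεlt m).trans_le (min_le_left _ _)
  set b : Fin n → ℕ → ENNReal :=
    fun j m => volume (K j ∩ thickening (ε m) (frontier Ω)) / ENNReal.ofReal (2 * ε m) with hb
  have hHb : ∀ m, H ≤ ∑ j, b j m := fun m => by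
    have hpos : ENNReal.ofReal (2 * ε m) ≠ 0 := by simpa using hε0 m
    have h1 : volume (thickening (ε m) (frontier Ω)) ≤
        ∑ j, volume (K j ∩ thickening (ε m) (frontier Ω)) := by
      refine (measure_mono fun x hx => ?_).trans (measure_iUnion_fintype_le _ _)
      obtain ⟨j, hj⟩ := mem_iUnion.1 (hKcov (hε₁c (thickening_mono (hε1 m).le _ hx)))
      exact mem_iUnion.2 ⟨j, hj, hx⟩
    have h2 : ∑ j, b j m =
        (∑ j, volume (K j ∩ thickening (ε m) (frontier Ω))) / ENNReal.ofReal (2 * ε m) := by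
      simp only [hb, div_eq_mul_inv, Finset.sum_mul]
    rw [h2, ENNReal.le_div_iff_mul_le (Or.inl hpos) (Or.inl ENNReal.ofReal_ne_top), mul_comm]
    exact (hviol m).le.trans h1
  set I : Fin n → ENNReal :=
    fun j => ∫⁻ y in (c j).param ⁻¹' K j, ENNReal.ofReal ((c j).areaElement y)
  have hθI : ∀ j, ENNReal.ofReal θ * I j ≤ μH[(k : ℝ)] (frontier Ω ∩ K j) := fun j =>
    (hθ' Ω (c j) _ ((c j).continuous_param.measurable (hK j).measurableSet)).trans
      (measure_mono (hsub j))
  have hIfin : ∀ j, I j ≠ ⊤ := fun j h => by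
    have h1 := (hθI j).trans (measure_mono inter_subset_left)
    rw [h, ENNReal.mul_top (by simpa using zero_lt_one.trans hθ)] at h1
    exact absurd hHfin (by simpa using h1)
  have hlim : ∀ j, limsup (b j) atTop ≤ I j := fun j =>
    (c j).limsup_volume_thickening_le hΩ (hK j) (hKr j) hε0 hεlim
      fun m => by linarith [hε₁r j, hε1 m]
  have hHI : H ≤ ∑ j, I j := by
    refine ENNReal.le_of_forall_pos_le_add fun η hη _ => ?_
    have h1 : ∀ᶠ m in atTop, ∀ j, b j m < I j + η / (n + 1) := eventually_all.2 fun j =>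
      eventually_lt_of_limsup_lt ((hlim j).trans_lt (ENNReal.lt_add_right (hIfin j)
        (ENNReal.div_ne_zero.2 ⟨by simpa using hη.ne', by finiteness⟩)))
    obtain ⟨m, hm⟩ := h1.exists
    refine (hHb m).trans ((Finset.sum_le_sum fun j _ => (hm j).le).trans ?_)
    rw [Finset.sum_add_distrib]
    gcongr
    rw [Finset.sum_const, Finset.card_univ, Fintype.card_fin, nsmul_eq_mul]
    calc (n : ENNReal) * (η / (n + 1)) ≤ (n + 1) * (η / (n + 1)) := by gcongr; simp
      _ ≤ η := ENNReal.mul_div_le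
  have hsum : ∑ j, μH[(k : ℝ)] (frontier Ω ∩ K j) ≤ H := by
    have h1 : ∀ j, μH[(k : ℝ)] (frontier Ω ∩ K j) ≤ μH[(k : ℝ)] (frontier Ω ∩ D j) := fun j => by
      refine (measure_mono (t := (frontier Ω ∩ D j) ∪ (frontier Ω ∩ (K j \ D j)))
        fun x hx => ?_).trans ((measure_union_le _ _).trans (by rw [hnull j, add_zero]))
      by_cases h : x ∈ D j
      · exact Or.inl ⟨hx.1, h⟩
      · exact Or.inr ⟨hx.1, hx.2, h⟩
    refine (Finset.sum_le_sum fun j _ => h1 j).trans ?_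
    rw [← tsum_fintype (L := .unconditional _), ← measure_iUnion]
    · exact measure_mono (iUnion_subset fun j => inter_subset_left)
    · exact fun i j hij => (hDD hij).mono inter_subset_right inter_subset_right
    · exact fun j => isClosed_frontier.measurableSet.inter (hD j).measurableSet
  have hfinal : ENNReal.ofReal θ * H ≤ H := calc
    ENNReal.ofReal θ * H ≤ ENNReal.ofReal θ * ∑ j, I j := by gcongr
    _ = ∑ j, ENNReal.ofReal θ * I j := Finset.mul_sum _ _ _
    _ ≤ ∑ j, μH[(k : ℝ)] (frontier Ω ∩ K j) := Finset.sum_le_sum fun j _ => hθI j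
    _ ≤ H := hsum
  have hH0 : H ≠ 0 := fun h0 => by
    obtain ⟨c, rfl, hr⟩ := hch x₀ hx₀
    have hT : IsOpen (c.param ⁻¹' ball c.center c.radius) :=
      isOpen_ball.preimage c.continuous_param
    have hTne : (c.param ⁻¹' ball c.center c.radius).Nonempty :=
      ⟨c.base c.center, by
        rw [mem_preimage, c.param_base hΩ hx₀ (mem_ball_self hr)]; exact mem_ball_self hr⟩
    have h1 := hθ' Ω c _ hT.measurableSet
    have h2 : μH[(k : ℝ)] (c.param '' (c.param ⁻¹' ball c.center c.radius)) = 0 :=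
      measure_mono_null (by rintro _ ⟨y, hy, rfl⟩; exact c.param_mem_frontier hΩ hy) h0
    rw [h2, nonpos_iff_eq_zero, mul_eq_zero] at h1
    have h3 := h1.resolve_left (by simpa using zero_lt_one.trans hθ)
    refine (hT.measure_pos volume hTne).ne' (le_antisymm (h3 ▸ ?_) bot_le)
    calc volume (c.param ⁻¹' ball c.center c.radius)
        = ∫⁻ _ in c.param ⁻¹' ball c.center c.radius, 1 := by simp
      _ ≤ _ := lintegral_mono fun y => by
        simpa using ENNReal.ofReal_le_ofReal (c.one_le_areaElement y)
  refine absurd hfinal (not_le.2 ?_)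
  conv_lhs => rw [← one_mul H]
  exact ENNReal.mul_lt_mul_left hH0 hHfin.ne (by simpa using hθ)

end HigherDimension

section Plane

/-- The part of a disc not covered by a translate is controlled by the translation length. -/
lemma volume_ball_diff_ball_le (a b : EuclideanSpace ℝ (Fin (1 + 1))) {t : ℝ} (ht : 0 < t) :
    volume (ball a t \ ball b t) ≤ ENNReal.ofReal (2 * t) * edist a b := by
  set e : EuclideanSpace ℝ (Fin (1 + 1)) := EuclideanSpace.single (Fin.last 1) (dist a b)
  have he : ‖b - a‖ = ‖e‖ := by
    simp [e, dist_eq_norm, norm_sub_rev]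
  set A := (ℝ ∙ ((b - a) - e))ᗮ.reflection
  have hA : A (b - a) = e := Submodule.reflection_sub he
  have hab : A b = A a + e := by rw [← hA, map_sub]; abel
  have hb1 : ∀ i : Fin 1, A b i.castSucc = A a i.castSucc := fun i => by
    rw [hab, PiLp.add_apply, PiLp.single_apply, if_neg (Fin.castSucc_lt_last i).ne,
      add_zero]
  have hb2 : A b (Fin.last 1) = A a (Fin.last 1) + dist a b := by
    rw [hab]; simp [e]
  rw [(volume_eq_lintegral_slices A (measurableSet_ball.diff measurableSet_ball)).2]
  set α : Fin 1 → ℝ := fun i => A a i.castSucc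
  have hbd : ∀ y : Fin 1 → ℝ, volume {τ : ℝ | A.symm (graphPt y τ) ∈ ball a t \ ball b t} ≤
      (ball α t).indicator (fun _ => edist a b) y := by
    intro y
    have hda : ∀ τ z, dist (A.symm (graphPt y τ)) z ^ 2 =
        ∑ i : Fin 1, (y i - A z i.castSucc) ^ 2 + (τ - A z (Fin.last 1)) ^ 2 := fun τ z => by
      
      rw [← A.dist_map, dist_sq_eq]
      simp only [LinearIsometryEquiv.apply_symm_apply, graphPt_castSucc, graphPt_last]
    have hlt : ∀ τ z, dist (A.symm (graphPt y τ)) z < t ↔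
        ∑ i : Fin 1, (y i - A z i.castSucc) ^ 2 + (τ - A z (Fin.last 1)) ^ 2 < t ^ 2 :=
      fun τ z => by rw [← hda, sq_lt_sq₀ dist_nonneg ht.le]
    simp only [Set.mem_sdiff, mem_ball, hlt, hb1, hb2]
    set q := ∑ i : Fin 1, (y i - A a i.castSucc) ^ 2 with hq
    set h := A a (Fin.last 1)
    by_cases hy : y ∈ ball α t
    · rw [indicator_of_mem hy]
      have hq' : q < t ^ 2 := by
        have := mem_ball.1 hy
        rw [hq]
        simp only [Finset.univ_unique, Fin.default_eq_zero, Finset.sum_singleton]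
        have h2 := (dist_le_pi_dist y α 0).trans_lt this
        rw [Real.dist_eq] at h2
        exact sq_lt_sq' (abs_lt.1 h2).1 (abs_lt.1 h2).2
      set ρ := √(t ^ 2 - q)
      have hρ : 0 ≤ ρ := Real.sqrt_nonneg _
      have hρ2 : ρ ^ 2 = t ^ 2 - q := Real.sq_sqrt (by linarith)
      have hsub : {τ : ℝ | q + (τ - h) ^ 2 < t ^ 2 ∧ ¬ q + (τ - (h + dist a b)) ^ 2 < t ^ 2} ⊆
          Icc (h - ρ) (h - ρ + dist a b) := by
        rintro τ ⟨h1, h2⟩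
        have h3 : |τ - h| < ρ := abs_lt_of_sq_lt_sq (by linarith) hρ
        rw [abs_lt] at h3
        refine ⟨by linarith, ?_⟩
        by_contra! h4
        refine h2 ?_
        have : (τ - (h + dist a b)) ^ 2 < ρ ^ 2 :=
          sq_lt_sq' (by linarith) (by linarith [dist_nonneg (x := a) (y := b)])
        linarith
      refine (measure_mono hsub).trans ?_
      rw [Real.volume_Icc, edist_dist]
      exact ENNReal.ofReal_le_ofReal (by linarith)
    · have hq' : t ^ 2 ≤ q := by
        have h1 : t ≤ dist y α := not_lt.1 hy
        have h2 : dist y α ≤ |y 0 - α 0| := (dist_pi_le_iff (abs_nonneg _)).2 fun i => by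
          rw [Subsingleton.elim i 0, Real.dist_eq]
        rw [hq]
        simp only [Finset.univ_unique, Fin.default_eq_zero, Finset.sum_singleton]
        rw [← sq_abs (y 0 - _)]
        gcongr
        exact h1.trans h2
      have : {τ : ℝ | q + (τ - h) ^ 2 < t ^ 2 ∧ ¬ q + (τ - (h + dist a b)) ^ 2 < t ^ 2} = ∅ :=
        eq_empty_of_forall_notMem fun τ hτ => by
          have := hτ.1
          nlinarith [sq_nonneg (τ - h)]
      rw [this, measure_empty]
      exact bot_le
  refine (lintegral_mono hbd).trans ?_
  rw [lintegral_indicator_const measurableSet_ball, Real.volume_pi_ball _ ht, mul_comm]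
  simp

/-- The pairs `(x, t)` for which exactly one of `a`, `b` lies in the disc of radius `t` at `x`. -/
def crossingSet (a b : EuclideanSpace ℝ (Fin (1 + 1))) :
    Set (EuclideanSpace ℝ (Fin (1 + 1)) × ℝ) :=
  {q | ¬ (dist q.1 a < q.2 ↔ dist q.1 b < q.2)}

lemma measurableSet_crossingSet (a b : EuclideanSpace ℝ (Fin (1 + 1))) :
    MeasurableSet (crossingSet a b) := by
  have h : ∀ c : EuclideanSpace ℝ (Fin (1 + 1)),
      MeasurableSet {q : EuclideanSpace ℝ (Fin (1 + 1)) × ℝ | dist q.1 c < q.2} := fun c =>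
    measurableSet_lt (by fun_prop) measurable_snd
  exact ((h a).iff (h b)).compl

lemma volume_crossingSet_le (a b : EuclideanSpace ℝ (Fin (1 + 1))) {t : ℝ} (ht : 0 < t) :
    volume {x | (x, t) ∈ crossingSet a b} ≤ ENNReal.ofReal (4 * t) * edist a b := by
  have hsub : {x | (x, t) ∈ crossingSet a b} ⊆ (ball a t \ ball b t) ∪ (ball b t \ ball a t) := by
    intro x hx
    simp only [crossingSet, mem_ofPred_eq] at hx
    simp only [mem_union, Set.mem_sdiff, mem_ball]
    tauto
  refine (measure_mono hsub).trans ((measure_union_le _ _).trans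
    ((add_le_add (volume_ball_diff_ball_le a b ht) (volume_ball_diff_ball_le b a ht)).trans ?_))
  rw [edist_comm b a, ← add_mul, ← ENNReal.ofReal_add (by positivity) (by positivity)]
  exact (congrArg (fun u => ENNReal.ofReal u * _) (by ring)).le

/-- If for every `x ∈ N` and almost every `t` in an interval two edges of a polygon of length at
most `H` cross the circle of radius `t` at `x`, the area of `N` is controlled by `H`. -/
lemma volume_le_of_crossings {ι : Type*} [Countable ι] {H : ENNReal}
    (a b : ℕ → ι → EuclideanSpace ℝ (Fin (1 + 1)))
    (hH : ∀ n, ∑' e, edist (a n e) (b n e) ≤ H)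
    {N : Set (EuclideanSpace ℝ (Fin (1 + 1)))} (hN : MeasurableSet N) {s u : ℝ} (hs : 0 ≤ s)
    (hsu : s < u)
    (h : ∀ x ∈ N, ∀ᵐ t, t ∈ Ioo s u → ∀ᶠ n in atTop, ∃ e₁ e₂, e₁ ≠ e₂ ∧
      (x, t) ∈ crossingSet (a n e₁) (b n e₁) ∧ (x, t) ∈ crossingSet (a n e₂) (b n e₂)) :
    volume N ≤ ENNReal.ofReal (2 * u) * H := by
  set S : ℕ → EuclideanSpace ℝ (Fin (1 + 1)) × ℝ → ENNReal :=
    fun n q => ∑' e, (crossingSet (a n e) (b n e)).indicator 1 q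
  have hSm : ∀ n, Measurable (S n) := fun n => Measurable.tsum fun e =>
    measurable_one.indicator (measurableSet_crossingSet _ _)
  set G : EuclideanSpace ℝ (Fin (1 + 1)) × ℝ → ENNReal := fun q => liminf (fun n => S n q) atTop
  have hGm : Measurable G := Measurable.liminf hSm
  have hup : ∀ t ∈ Ioo s u, ∫⁻ x, G (x, t) ≤ ENNReal.ofReal (4 * u) * H := by
    intro t ht
    have ht0 : 0 < t := hs.trans_lt ht.1
    refine (lintegral_liminf_le (f := fun n x => S n (x, t)) fun n => (hSm n).comp (by fun_prop)).trans ?_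
    refine liminf_le_of_le (by isBoundedDefault) fun B hB => ?_
    obtain ⟨n, hn⟩ := hB.exists
    refine hn.trans ?_
    simp only [S]
    rw [lintegral_tsum (f := fun e x => (crossingSet (a n e) (b n e)).indicator 1 (x, t))
      fun e => ((measurable_one.indicator
        (measurableSet_crossingSet _ _)).comp (by fun_prop)).aemeasurable]
    calc _ ≤ ∑' e, ENNReal.ofReal (4 * u) * edist (a n e) (b n e) := by
          refine ENNReal.tsum_le_tsum fun e => ?_
          have hm : MeasurableSet {x | (x, t) ∈ crossingSet (a n e) (b n e)} :=
            (measurableSet_crossingSet _ _).preimage (by fun_prop)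
          refine (lintegral_indicator_one hm).trans_le ?_
          refine (volume_crossingSet_le _ _ ht0).trans ?_
          gcongr
          exact ht.2.le
      _ = ENNReal.ofReal (4 * u) * ∑' e, edist (a n e) (b n e) := ENNReal.tsum_mul_left
      _ ≤ _ := by gcongr; exact hH n
  have hlow : ∀ x ∈ N, ENNReal.ofReal (u - s) * 2 ≤ ∫⁻ t in Ioo s u, G (x, t) := by
    intro x hx
    calc ENNReal.ofReal (u - s) * 2 = ∫⁻ _ in Ioo s u, (2 : ENNReal) := by
          rw [setLIntegral_const, Real.volume_Ioo, mul_comm]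
      _ ≤ _ := by
          refine setLIntegral_mono_ae (hGm.comp (by fun_prop)).aemeasurable ?_
          filter_upwards [h x hx] with t ht htI
          refine le_liminf_of_le (by isBoundedDefault) ?_
          filter_upwards [ht htI] with n ⟨e₁, e₂, hne, h1, h2⟩
          classical
          refine le_trans ?_ (ENNReal.sum_le_tsum {e₁, e₂})
          rw [Finset.sum_pair hne, indicator_of_mem h1, indicator_of_mem h2]
          norm_num
  have hne : ENNReal.ofReal (u - s) * 2 ≠ 0 := by simpa using hsu
  have hfin : ENNReal.ofReal (u - s) * 2 ≠ ⊤ := by finiteness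
  refine (ENNReal.mul_le_mul_iff_right hne hfin).1 ?_
  calc ENNReal.ofReal (u - s) * 2 * volume N
      = ∫⁻ _ in N, ENNReal.ofReal (u - s) * 2 := by rw [setLIntegral_const]
    _ ≤ ∫⁻ x in N, ∫⁻ t in Ioo s u, G (x, t) := setLIntegral_mono' hN hlow
    _ ≤ ∫⁻ x, ∫⁻ t in Ioo s u, G (x, t) := setLIntegral_le_lintegral _ _
    _ = ∫⁻ t in Ioo s u, ∫⁻ x, G (x, t) := lintegral_lintegral_swap hGm.aemeasurable
    _ ≤ ∫⁻ _ in Ioo s u, ENNReal.ofReal (4 * u) * H := setLIntegral_mono' measurableSet_Ioo hup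
    _ = ENNReal.ofReal (u - s) * 2 * (ENNReal.ofReal (2 * u) * H) := by
        rw [setLIntegral_const, Real.volume_Ioo, show 4 * u = 2 * (2 * u) by ring,
          ENNReal.ofReal_mul zero_le_two, ENNReal.ofReal_ofNat]
        ring

end Plane

section Plane

lemma edist_le_hausdorffMeasure_image_Ioc {X : Type*} [MetricSpace X] [MeasurableSpace X]
    [BorelSpace X] {g : ℝ → X} (hg : Continuous g) {α β : ℝ} (hαβ : α ≤ β) :
    edist (g α) (g β) ≤ μH[(1 : ℝ)] (g '' Ioc α β) := by
  have hsub : Ioc 0 (dist (g α) (g β)) ⊆ dist (g α) '' (g '' Ioc α β) := by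
    intro ρ hρ
    have hc : ContinuousOn (fun σ => dist (g α) (g σ)) (Icc α β) := by fun_prop
    obtain ⟨σ, hσ, hσρ⟩ := intermediate_value_Icc hαβ hc ⟨by simpa using hρ.1.le, hρ.2⟩
    refine ⟨g σ, ⟨σ, ⟨lt_of_le_of_ne hσ.1 fun h => ?_, hσ.2⟩, rfl⟩, hσρ⟩
    subst h
    simp only [dist_self] at hσρ
    exact hρ.1.ne hσρ
  have h1 := ((LipschitzWith.dist_right (g α)).lipschitzOnWith
    (s := g '' Ioc α β)).hausdorffMeasure_image_le (d := 1) zero_le_one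
  simp only [ENNReal.coe_one, ENNReal.one_rpow, one_mul] at h1
  refine le_trans ?_ h1
  refine le_trans ?_ (measure_mono hsub)
  rw [hausdorffMeasure_real, Real.volume_Ioc, sub_zero, edist_dist]

/-- A property that changes on an interval changes between consecutive points of a fine mesh. -/
lemma eventually_exists_mesh_change {P : ℝ → Prop} {α β : ℝ} {V₁ V₂ : Set ℝ} (hV₁ : IsOpen V₁)
    (hV₂ : IsOpen V₂) (hV₁' : V₁ ⊆ Ioo α β) (hV₂' : V₂ ⊆ Ioo α β) (hne₁ : V₁.Nonempty)
    (hne₂ : V₂.Nonempty) (hP₁ : ∀ σ ∈ V₁, P σ) (hP₂ : ∀ σ ∈ V₂, ¬ P σ) :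
    ∀ᶠ m : ℕ in atTop, ∃ i : ℤ, Icc (i / (m + 1) : ℝ) ((i + 1) / (m + 1)) ⊆ Ioo α β ∧
      ¬ (P (i / (m + 1)) ↔ P ((i + 1) / (m + 1))) := by
  have hpt : ∀ V : Set ℝ, IsOpen V → V.Nonempty →
      ∀ᶠ m : ℕ in atTop, ∃ i : ℤ, (i / (m + 1) : ℝ) ∈ V := by
    rintro V hV ⟨v, hv⟩
    obtain ⟨ρ, hρ, hρV⟩ := Metric.isOpen_iff.1 hV v hv
    filter_upwards [(tendsto_one_div_add_atTop_nhds_zero_nat (𝕜 := ℝ)).eventually_lt_const hρ]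
      with m hm
    have hm0 : (0 : ℝ) < m + 1 := by positivity
    refine ⟨⌊v * (m + 1)⌋, hρV ?_⟩
    have h1 : (⌊v * (m + 1)⌋ / (m + 1) : ℝ) ≤ v := (div_le_iff₀ hm0).2 (Int.floor_le _)
    have h2 : v < ⌊v * (m + 1)⌋ / (m + 1) + 1 / (m + 1) := by
      rw [← add_div, lt_div_iff₀ hm0]; exact Int.lt_floor_add_one _
    rw [mem_ball, Real.dist_eq, abs_lt]
    constructor <;> linarith
  filter_upwards [hpt V₁ hV₁ hne₁, hpt V₂ hV₂ hne₂] with m ⟨i₁, hi₁⟩ ⟨i₂, hi₂⟩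
  by_contra! hno
  have hm0 : (0 : ℝ) < m + 1 := by positivity
  have step : ∀ p q : ℤ, p ≤ q → (p / (m + 1) : ℝ) ∈ Ioo α β → (q / (m + 1) : ℝ) ∈ Ioo α β →
      (P (p / (m + 1)) ↔ P (q / (m + 1))) := by
    intro p q hpq hp
    induction q, hpq using Int.leInduction with
    | base => exact fun _ => Iff.rfl
    | succ q hpq ih =>
      intro hq
      push_cast at hq ⊢
      have h1 : (p / (m + 1) : ℝ) ≤ q / (m + 1) := by gcongr
      have h2 : (q / (m + 1) : ℝ) ≤ (q + 1) / (m + 1) := by gcongr; linarith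
      exact (ih ⟨hp.1.trans_le h1, h2.trans_lt hq.2⟩).trans
        (hno q fun σ hσ => ⟨(hp.1.trans_le h1).trans_le hσ.1, hσ.2.trans_lt hq.2⟩)
  rcases le_total i₁ i₂ with h | h
  · exact hP₂ _ hi₂ ((step _ _ h (hV₁' hi₁) (hV₂' hi₂)).1 (hP₁ _ hi₁))
  · exact hP₂ _ hi₂ ((step _ _ h (hV₂' hi₂) (hV₁' hi₁)).2 (hP₁ _ hi₁))

/-- The last time at which a continuous function crosses a level upwards. -/
lemma exists_last_crossing {u : ℝ → ℝ} (hu : Continuous u) {t m : ℝ} (hm : 0 ≤ m) (h0 : u 0 < t)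
    (h1 : t < u m) :
    ∃ σ, 0 < σ ∧ σ < m ∧ u σ = t ∧ σ ∈ closure {σ' | u σ' < t} ∧ ∀ σ' ∈ Ioc σ m, t ≤ u σ' := by
  set A := {σ | σ ∈ Icc 0 m ∧ u σ < t}
  have hA0 : (0 : ℝ) ∈ A := ⟨⟨le_rfl, hm⟩, h0⟩
  have hbdd : BddAbove A := ⟨m, fun σ hσ => hσ.1.2⟩
  have hcl : sSup A ∈ closure A := csSup_mem_closure ⟨0, hA0⟩ hbdd
  have hcl' : sSup A ∈ closure {σ' | u σ' < t} := closure_mono (fun σ hσ => hσ.2) hcl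
  have hle : u (sSup A) ≤ t :=
    closure_minimal (fun σ hσ => le_of_lt hσ) (isClosed_le hu continuous_const) hcl'
  have hm' : sSup A < m := lt_of_le_of_ne (csSup_le ⟨0, hA0⟩ fun σ hσ => hσ.1.2)
    fun h => by rw [h] at hle; linarith
  have h0' : 0 ≤ sSup A := le_csSup hbdd hA0
  have hge : ∀ σ' ∈ Ioc (sSup A) m, t ≤ u σ' := fun σ' hσ' => by
    by_contra! h
    exact absurd (le_csSup hbdd (⟨⟨h0'.trans hσ'.1.le, hσ'.2⟩, h⟩ : σ' ∈ A)) (not_le.2 hσ'.1)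
  have heq : u (sSup A) = t := le_antisymm hle <| by
    refine ge_of_tendsto (hu.continuousWithinAt (s := Ioi (sSup A)) (x := sSup A)) ?_
    filter_upwards [Ioc_mem_nhdsGT hm'] using hge
  refine ⟨sSup A, lt_of_le_of_ne h0' fun h => ?_, hm', heq, hcl', hge⟩
  rw [← h] at heq
  exact h0.ne heq

namespace BoundaryChart

variable {Ω : Set (EuclideanSpace ℝ (Fin (1 + 1)))} (c : BoundaryChart Ω)

/-- The parametrization of a boundary curve by a real variable. -/
noncomputable def curve (σ : ℝ) : EuclideanSpace ℝ (Fin (1 + 1)) := c.param fun _ => σ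

/-- The real parameter of a point. -/
noncomputable def coord (z : EuclideanSpace ℝ (Fin (1 + 1))) : ℝ := c.base z 0

lemma continuous_curve : Continuous c.curve := c.continuous_param.comp (by fun_prop)

lemma continuous_coord : Continuous c.coord := (continuous_apply 0).comp c.continuous_base

@[simp] lemma coord_curve (σ : ℝ) : c.coord (c.curve σ) = σ := by simp [coord, curve]

lemma curve_injective : Function.Injective c.curve := Function.LeftInverse.injective c.coord_curve

lemma abs_coord_sub_le (z w : EuclideanSpace ℝ (Fin (1 + 1))) :
    |c.coord z - c.coord w| ≤ dist z w := by
  rw [← Real.dist_eq]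
  exact (dist_le_pi_dist _ _ _).trans (c.dist_base_le z w)

lemma curve_coord (hΩ : IsOpen Ω) {z : EuclideanSpace ℝ (Fin (1 + 1))} (h : z ∈ frontier Ω)
    (hz : z ∈ ball c.center c.radius) : c.curve (c.coord z) = z := by
  conv_rhs => rw [← c.param_base hΩ h hz]
  exact congrArg c.param (funext fun i => congrArg (c.base z) (Subsingleton.elim _ _))

lemma curve_mem_frontier (hΩ : IsOpen Ω) {σ : ℝ} (h : c.curve σ ∈ ball c.center c.radius) :
    c.curve σ ∈ frontier Ω := c.param_mem_frontier hΩ h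

end BoundaryChart

variable {Ω : Set (EuclideanSpace ℝ (Fin (1 + 1)))}

/-- Arbitrarily close to `y` there are arcs of the boundary inside and arcs outside the open disc
of radius `t` at `x`. -/
def CrossesAt (Ω : Set (EuclideanSpace ℝ (Fin (1 + 1)))) (x : EuclideanSpace ℝ (Fin (1 + 1)))
    (t : ℝ) (y : EuclideanSpace ℝ (Fin (1 + 1))) : Prop :=
  ∀ V, IsOpen V → y ∈ V → ∃ V₁ V₂, IsOpen V₁ ∧ IsOpen V₂ ∧ V₁ ⊆ V ∧ V₂ ⊆ V ∧
    (frontier Ω ∩ V₁).Nonempty ∧ (frontier Ω ∩ V₂).Nonempty ∧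
    (∀ q ∈ frontier Ω ∩ V₁, dist x q < t) ∧ ∀ q ∈ frontier Ω ∩ V₂, ¬ dist x q < t

/-- Near a boundary point at distance less than `t` from `x` the boundary curve crosses the circle
of radius `t` at `x` on either side. -/
lemma BoundaryChart.exists_crossesAt (c : BoundaryChart Ω) (hΩ : IsOpen Ω)
    {x p : EuclideanSpace ℝ (Fin (1 + 1))} {t : ℝ} (hp : p ∈ frontier Ω) (hxp : dist x p < t)
    (hpt : dist p c.center + 2 * t ≤ c.radius) {τ : ℝ} (hτ : τ * τ = 1) :
    ∃ y ∈ frontier Ω, dist x y = t ∧ CrossesAt Ω x t y ∧ 0 < τ * (c.coord y - c.coord p) := by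
  have ht : 0 < t := dist_nonneg.trans_lt hxp
  have hpb : p ∈ ball c.center c.radius := by rw [mem_ball]; linarith
  set h : ℝ → EuclideanSpace ℝ (Fin (1 + 1)) := fun σ => c.curve (c.coord p + τ * σ)
  have hh : Continuous h := c.continuous_curve.comp (by fun_prop)
  have hcoord : ∀ σ, τ * (c.coord (h σ) - c.coord p) = σ := fun σ => by
    simp only [h, c.coord_curve]
    linear_combination σ * hτ
  have hback : ∀ q ∈ frontier Ω, q ∈ ball c.center c.radius →
      h (τ * (c.coord q - c.coord p)) = q := fun q hq hqb => by
    simp only [h, ← mul_assoc, hτ, one_mul, add_sub_cancel, c.curve_coord hΩ hq hqb]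
  have hball : ∀ σ, dist x (h σ) ≤ t → h σ ∈ ball c.center c.radius := fun σ hσ => by
    rw [mem_ball]
    have := dist_triangle4 (h σ) x p c.center
    rw [dist_comm (h σ) x] at this
    linarith
  have hfr : ∀ σ, h σ ∈ ball c.center c.radius → h σ ∈ frontier Ω := fun σ hσ =>
    c.curve_mem_frontier hΩ hσ
  have h0 : h 0 = p := by simpa using hback p hp hpb
  have h2t : t < dist x (h (2 * t)) := by
    have h1 := c.abs_coord_sub_le x (h (2 * t))
    have h2 := c.abs_coord_sub_le x p
    have h3 : |τ| = 1 := by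
      rcases mul_self_eq_one_iff.1 hτ with rfl | rfl <;> simp
    have h4 : |τ * (2 * t)| = 2 * t := by rw [abs_mul, h3, abs_of_pos (by positivity)]; ring
    simp only [h, c.coord_curve] at h1
    have h5 : |τ * (2 * t)| ≤ |c.coord x - c.coord p| + |c.coord x - (c.coord p + τ * (2 * t))| := by
      refine le_trans (le_of_eq ?_) (abs_sub (c.coord x - c.coord p) _)
      congr 1; ring
    simp only [h]
    linarith
  obtain ⟨σ, hσ0, hσ2, hσt, hσcl, hσge⟩ := exists_last_crossing
    (u := fun σ => dist x (h σ)) (by fun_prop) (m := 2 * t) (by positivity)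
    (by simpa [h0] using hxp) h2t
  have hσb := hball σ hσt.le
  refine ⟨h σ, hfr σ hσb, hσt, fun V hV hyV => ?_, by rwa [hcoord]⟩
  have hVb : IsOpen (h ⁻¹' (V ∩ ball c.center c.radius)) := (hV.inter isOpen_ball).preimage hh
  obtain ⟨σ₁, hσ₁, hσ₁t⟩ := mem_closure_iff.1 hσcl _ hVb ⟨hyV, hσb⟩
  obtain ⟨σ₂, hσ₂, hσ₂I⟩ := Filter.nonempty_of_mem
    (inter_mem (nhdsWithin_le_nhds (hVb.mem_nhds ⟨hyV, hσb⟩)) (Ioo_mem_nhdsGT hσ2))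
  refine ⟨V ∩ ball c.center c.radius ∩ {q | dist x q < t},
    V ∩ ball c.center c.radius ∩ {q | τ * (c.coord q - c.coord p) ∈ Ioo σ (2 * t)},
    (hV.inter isOpen_ball).inter (isOpen_lt (by fun_prop) continuous_const),
    (hV.inter isOpen_ball).inter (isOpen_Ioo.preimage
      (continuous_const.mul (c.continuous_coord.sub continuous_const))),
    fun q hq => hq.1.1, fun q hq => hq.1.1, ⟨h σ₁, hfr σ₁ hσ₁.2, hσ₁, hσ₁t⟩,
    ⟨h σ₂, hfr σ₂ hσ₂.2, hσ₂, by simpa only [mem_ofPred_eq, hcoord] using hσ₂I⟩,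
    fun q hq => hq.2.2, ?_⟩
  rintro q ⟨hq, ⟨hq1, hq2⟩, hq3⟩
  rw [← hback q hq hq2]
  exact not_lt.2 (hσge _ ⟨hq3.1, hq3.2.le⟩)

/-- Near a crossing point an edge of a fine polygon crosses the circle. -/
lemma CrossesAt.eventually_exists_edge (hΩ : IsOpen Ω) {c : BoundaryChart Ω}
    {D W : Set (EuclideanSpace ℝ (Fin (1 + 1)))} (hD : IsOpen D)
    (hDc : D ⊆ ball c.center c.radius) (hW : IsOpen W) {x y : EuclideanSpace ℝ (Fin (1 + 1))}
    {t : ℝ} (hcr : CrossesAt Ω x t y) (hy : y ∈ frontier Ω) (hyD : y ∈ D) (hyW : y ∈ W) :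
    ∀ᶠ m : ℕ in atTop, ∃ i : ℤ, Icc (i / (m + 1) : ℝ) ((i + 1) / (m + 1)) ⊆ c.curve ⁻¹' D ∧
      c.curve (i / (m + 1)) ∈ W ∧
      (x, t) ∈ crossingSet (c.curve (i / (m + 1))) (c.curve ((i + 1) / (m + 1))) := by
  have hyc : c.curve (c.coord y) = y := c.curve_coord hΩ hy (hDc hyD)
  obtain ⟨η, hη, hηU⟩ := Metric.isOpen_iff.1 ((hD.inter hW).preimage c.continuous_curve)
    (c.coord y) (by rw [mem_preimage, hyc]; exact ⟨hyD, hyW⟩)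
  obtain ⟨V₁, V₂, hV₁, hV₂, hV₁', hV₂', ⟨q₁, hq₁, hq₁'⟩, ⟨q₂, hq₂, hq₂'⟩, hP₁, hP₂⟩ :=
    hcr (D ∩ c.coord ⁻¹' ball (c.coord y) η) (hD.inter (isOpen_ball.preimage c.continuous_coord))
      ⟨hyD, mem_ball_self hη⟩
  rw [Real.ball_eq_Ioo] at *
  have hsub : ∀ V ⊆ D ∩ c.coord ⁻¹' Ioo (c.coord y - η) (c.coord y + η),
      c.curve ⁻¹' V ⊆ Ioo (c.coord y - η) (c.coord y + η) := fun V hV σ hσ => by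
    simpa using (hV hσ).2
  have hfr : ∀ V ⊆ D ∩ c.coord ⁻¹' Ioo (c.coord y - η) (c.coord y + η), ∀ σ ∈ c.curve ⁻¹' V,
      c.curve σ ∈ frontier Ω ∩ V := fun V hV σ hσ =>
    ⟨c.curve_mem_frontier hΩ (hDc (hV hσ).1), hσ⟩
  have hne : ∀ V ⊆ D ∩ c.coord ⁻¹' Ioo (c.coord y - η) (c.coord y + η), ∀ q ∈ frontier Ω,
      q ∈ V → (c.curve ⁻¹' V).Nonempty := fun V hV q hq hqV =>
    ⟨c.coord q, by rwa [mem_preimage, c.curve_coord hΩ hq (hDc (hV hqV).1)]⟩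
  filter_upwards [eventually_exists_mesh_change (P := fun σ => dist x (c.curve σ) < t)
    (hV₁.preimage c.continuous_curve) (hV₂.preimage c.continuous_curve) (hsub V₁ hV₁')
    (hsub V₂ hV₂') (hne V₁ hV₁' q₁ hq₁ hq₁') (hne V₂ hV₂' q₂ hq₂ hq₂')
    (fun σ hσ => hP₁ _ (hfr V₁ hV₁' σ hσ)) (fun σ hσ => hP₂ _ (hfr V₂ hV₂' σ hσ))]
    with m ⟨i, hi, hi'⟩
  have hle : (i / (m + 1) : ℝ) ≤ (i + 1) / (m + 1) := by gcongr; linarith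
  exact ⟨i, fun σ hσ => (hηU (hi hσ)).1, (hηU (hi (left_mem_Icc.2 hle))).2, hi'⟩

/-- The edges of an inscribed polygon inside disjoint open sets have total length at most the
length of the boundary. -/
lemma tsum_edist_edges_le (hΩ : IsOpen Ω) {n : ℕ} (c : Fin n → BoundaryChart Ω)
    (D : Fin n → Set (EuclideanSpace ℝ (Fin (1 + 1)))) (hDD : Pairwise (Function.onFun Disjoint D))
    (hDc : ∀ j, D j ⊆ ball (c j).center (c j).radius)
    (m : ℕ) (b : Fin n × ℤ → EuclideanSpace ℝ (Fin (1 + 1)))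
    (hb : ∀ e : Fin n × ℤ, b e = (c e.1).curve (e.2 / (m + 1)) ∨
      Icc (e.2 / (m + 1) : ℝ) ((e.2 + 1) / (m + 1)) ⊆ (c e.1).curve ⁻¹' D e.1 ∧
        b e = (c e.1).curve ((e.2 + 1) / (m + 1))) :
    ∑' e, edist ((c e.1).curve (e.2 / (m + 1))) (b e) ≤ μH[(1 : ℝ)] (frontier Ω) := by
  have hm0 : (0 : ℝ) < m + 1 := by positivity
  set P : Fin n × ℤ → Set (EuclideanSpace ℝ (Fin (1 + 1))) := fun e =>
    {z | Icc (e.2 / (m + 1) : ℝ) ((e.2 + 1) / (m + 1)) ⊆ (c e.1).curve ⁻¹' D e.1 ∧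
      z ∈ (c e.1).curve '' Ioc (e.2 / (m + 1) : ℝ) ((e.2 + 1) / (m + 1))}
  have hPD : ∀ e, P e ⊆ D e.1 := by
    rintro e _ ⟨h, σ, hσ, rfl⟩
    exact h (Ioc_subset_Icc_self hσ)
  have hPm : ∀ e, MeasurableSet (P e) := fun e => (MeasurableSet.const _).inter
    (((c e.1).continuous_curve.measurableEmbedding
      (c e.1).curve_injective).measurableSet_image.2 measurableSet_Ioc)
  have hdisj : Pairwise (Function.onFun Disjoint P) := by
    rintro ⟨j, i⟩ ⟨j', i'⟩ hne
    by_cases hj : j = j'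
    · subst hj
      refine disjoint_left.2 ?_
      rintro _ ⟨-, σ, hσ, rfl⟩ ⟨-, σ', hσ', h⟩
      rw [(c j).curve_injective h] at hσ'
      refine hne (Prod.ext rfl ?_)
      simp only [mem_Ioc, div_lt_iff₀ hm0, le_div_iff₀ hm0] at hσ hσ'
      have h1 : (i : ℝ) < i' + 1 := hσ.1.trans_le hσ'.2
      have h2 : (i' : ℝ) < i + 1 := hσ'.1.trans_le hσ.2
      norm_cast at h1 h2
      simp only
      omega
    · exact (hDD hj).mono (hPD _) (hPD _)
  calc _ ≤ ∑' e, μH[(1 : ℝ)] (P e) := by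
        refine ENNReal.tsum_le_tsum fun e => ?_
        rcases hb e with h | ⟨h, h'⟩
        · simp [h]
        · rw [h']
          refine (edist_le_hausdorffMeasure_image_Ioc (c e.1).continuous_curve
            (by gcongr; linarith)).trans (measure_mono fun z hz => ⟨h, hz⟩)
    _ = μH[(1 : ℝ)] (⋃ e, P e) := (measure_iUnion hdisj hPm).symm
    _ ≤ _ := by
        refine measure_mono (iUnion_subset ?_)
        rintro e _ ⟨h, σ, hσ, rfl⟩
        exact (c e.1).curve_mem_frontier hΩ (hDc _ (h (Ioc_subset_Icc_self hσ)))

lemma exists_volume_thickening_le_of_plane (hΩ : IsOpen Ω) (hΩb : Bornology.IsBounded Ω)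
    (hch : ∀ x ∈ frontier Ω, ∃ c : BoundaryChart Ω, c.center = x ∧ 0 < c.radius) :
    ∃ ε₀ : ℝ, 0 < ε₀ ∧ ∀ ε : ℝ, 0 < ε → ε < ε₀ →
      volume (thickening ε (frontier Ω)) ≤ ENNReal.ofReal (2 * ε) * μH[(1 : ℝ)] (frontier Ω) := by
  have hHfin := hausdorffMeasure_frontier_lt_top hΩ hΩb hch
  obtain ⟨n, c, r, K, D, hr, hcov, hK, hKr, hKcov, hD, hDK, hDD, hnull⟩ :=
    exists_boundary_decomposition hΩ hΩb hch
  rw [Nat.cast_one] at hHfin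
  simp only [Nat.cast_one] at hnull
  obtain ⟨ε₁, hε₁, hε₁r, -⟩ := exists_uniform_tube hΩb c r hr hcov
  have hDc : ∀ j, D j ⊆ ball (c j).center (c j).radius := fun j =>
    (hDK j).trans ((hKr j).trans (closedBall_subset_ball (hr j)))
  have hbad : μH[(1 : ℝ)] (frontier Ω \ ⋃ j, D j) = 0 := by
    refine measure_mono_null (t := ⋃ j, frontier Ω ∩ (K j \ D j)) (fun z hz => ?_)
      (measure_iUnion_null hnull)
    obtain ⟨j, hj⟩ := mem_iUnion.1 (hKcov (hcov hz.1))
    exact mem_iUnion.2 ⟨j, hz.1, hj, fun h => hz.2 (mem_iUnion.2 ⟨j, h⟩)⟩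
  refine ⟨ε₁ / 2, by positivity, fun ε hε hε2 => ?_⟩
  have key : ∀ u ∈ Ioo ε (ε₁ / 2), volume (thickening ε (frontier Ω)) ≤
      ENNReal.ofReal (2 * u) * μH[(1 : ℝ)] (frontier Ω) := by
    classical
    intro u hu
    refine volume_le_of_crossings (ι := Fin n × ℤ)
      (fun m e => (c e.1).curve (e.2 / (m + 1)))
      (fun m e => if Icc (e.2 / (m + 1) : ℝ) ((e.2 + 1) / (m + 1)) ⊆ (c e.1).curve ⁻¹' D e.1
        then (c e.1).curve ((e.2 + 1) / (m + 1)) else (c e.1).curve (e.2 / (m + 1)))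
      (fun m => tsum_edist_edges_le hΩ c D hDD hDc m _ fun e => by
        split_ifs with h
        · exact Or.inr ⟨h, rfl⟩
        · exact Or.inl rfl)
      isOpen_thickening.measurableSet hε.le hu.1 fun x hx => ?_
    have hnull' : volume (dist x '' (frontier Ω \ ⋃ j, D j)) = 0 := by
      have h1 := ((LipschitzWith.dist_right x).lipschitzOnWith
        (s := frontier Ω \ ⋃ j, D j)).hausdorffMeasure_image_le (d := 1) zero_le_one
      rw [hbad, mul_zero, hausdorffMeasure_real] at h1
      exact le_antisymm h1 bot_le
    filter_upwards [measure_eq_zero_iff_ae_notMem.1 hnull'] with t htn ht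
    obtain ⟨p, hp, hxp⟩ := mem_thickening_iff.1 hx
    obtain ⟨j, hj⟩ := mem_iUnion.1 (hcov hp)
    have hpt : dist p (c j).center + 2 * t ≤ (c j).radius := by
      linarith [mem_ball.1 hj, hε₁r j, ht.2, hu.2]
    have hmem : ∀ y ∈ frontier Ω, dist x y = t → ∃ l, y ∈ D l := fun y hy hyt => by
      by_contra hno
      exact htn ⟨y, ⟨hy, by simpa using hno⟩, hyt⟩
    obtain ⟨y, hy, hyt, hyc, hy0⟩ := (c j).exists_crossesAt hΩ hp (hxp.trans ht.1) hpt
      (one_mul (1 : ℝ))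
    obtain ⟨z, hz, hzt, hzc, hz0⟩ := (c j).exists_crossesAt hΩ hp (hxp.trans ht.1) hpt
      (show (-1 : ℝ) * -1 = 1 by norm_num)
    have hyz : y ≠ z := by
      rintro rfl
      linarith
    obtain ⟨l, hl⟩ := hmem y hy hyt
    obtain ⟨l', hl'⟩ := hmem z hz hzt
    obtain ⟨U, V, hU, hV, hyU, hzV, hUV⟩ := t2_separation hyz
    filter_upwards [hyc.eventually_exists_edge hΩ (hD l) (hDc l) hU hy hl hyU,
      hzc.eventually_exists_edge hΩ (hD l') (hDc l') hV hz hl' hzV] with m ⟨i, hi, hiU, hi'⟩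
      ⟨i', hi2, hiV, hi2'⟩
    refine ⟨(l, i), (l', i'), fun h => ?_, by simpa only [if_pos hi] using hi',
      by simpa only [if_pos hi2] using hi2'⟩
    obtain ⟨rfl, rfl⟩ := Prod.mk.inj h
    exact disjoint_left.1 hUV hiU hiV
  have hlim : Tendsto (fun u : ℝ => ENNReal.ofReal (2 * u) * μH[(1 : ℝ)] (frontier Ω)) (𝓝[>] ε)
      (𝓝 (ENNReal.ofReal (2 * ε) * μH[(1 : ℝ)] (frontier Ω))) := by
    refine ENNReal.Tendsto.mul_const ?_ (Or.inr hHfin.ne)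
    exact (ENNReal.continuous_ofReal.comp (continuous_const.mul continuous_id)).continuousWithinAt
  refine ge_of_tendsto hlim ?_
  filter_upwards [Ioo_mem_nhdsGT hε2] using key

end Plane

lemma exists_volume_thickening_le_of_line {Ω : Set (EuclideanSpace ℝ (Fin (0 + 1)))}
    (hΩ : IsOpen Ω) (hΩb : Bornology.IsBounded Ω)
    (hch : ∀ x ∈ frontier Ω, ∃ c : BoundaryChart Ω, c.center = x ∧ 0 < c.radius) :
    ∃ ε₀ : ℝ, 0 < ε₀ ∧ ∀ ε : ℝ, 0 < ε → ε < ε₀ →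
      volume (thickening ε (frontier Ω)) ≤ ENNReal.ofReal (2 * ε) * μH[(0 : ℝ)] (frontier Ω) := by
  refine ⟨1, one_pos, fun ε _ _ => ?_⟩
  have hloc : ∀ x ∈ frontier Ω, ∃ U ∈ 𝓝 x, frontier Ω ∩ U ⊆ {x} := fun x hx => by
    obtain ⟨c, rfl, hr⟩ := hch x hx
    refine ⟨ball c.center c.radius, ball_mem_nhds _ hr, fun z hz => ?_⟩
    rw [mem_singleton_iff, ← c.param_base hΩ hz.1 hz.2, ← c.param_base hΩ hx (mem_ball_self hr)]
    exact congrArg c.param (Subsingleton.elim _ _)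
  choose! U hU hU' using hloc
  obtain ⟨s, hs, hsU⟩ := (isCompact_frontier_of_isBounded hΩb).elim_nhds_subcover U hU
  have hfs : frontier Ω = s := Subset.antisymm (fun z hz => by
    obtain ⟨x, hx, hzx⟩ := mem_iUnion₂.1 (hsU hz)
    rw [hU' x (hs x hx) ⟨hz, hzx⟩]
    exact hx) hs
  have hball : ∀ x : EuclideanSpace ℝ (Fin (0 + 1)),
      volume (ball x ε) ≤ ENNReal.ofReal (2 * ε) := fun x => by
    rw [(volume_eq_lintegral_slices (LinearIsometryEquiv.refl ℝ _) measurableSet_ball).2]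
    calc _ ≤ ∫⁻ _ : Fin 0 → ℝ, ENNReal.ofReal (2 * ε) := lintegral_mono fun y => by
          rw [← Real.volume_ball (x (Fin.last 0))]
          refine measure_mono fun τ hτ => ?_
          have h1 : dist (graphPt y τ) x < ε := hτ
          rw [mem_ball, Real.dist_eq]
          refine lt_of_le_of_lt (abs_le_of_sq_le_sq (b := dist (graphPt y τ) x) ?_ dist_nonneg) h1
          rw [dist_sq_eq, graphPt_last]
          exact le_add_of_nonneg_left (Finset.sum_nonneg fun i _ => sq_nonneg _)
      _ = _ := by rw [lintegral_const, volume_pi, Measure.pi_of_empty]; simp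
  have hH : μH[(0 : ℝ)] (frontier Ω) = s.card := by
    rw [hfs, ← sum_measure_singleton]
    simp [Measure.hausdorffMeasure_zero_singleton]
  rw [hH, hfs]
  calc volume (thickening ε (s : Set (EuclideanSpace ℝ (Fin (0 + 1)))))
      ≤ ∑ x ∈ s, volume (ball x ε) := by
        rw [thickening_eq_biUnion_ball]
        exact measure_biUnion_finset_le s _
    _ ≤ ∑ x ∈ s, ENNReal.ofReal (2 * ε) := Finset.sum_le_sum fun x _ => hball x
    _ = _ := by rw [Finset.sum_const, nsmul_eq_mul, mul_comm]

/-- The gradient of the cutoff `min 1 (ε⁻¹ d(x, F))` is at most `ε⁻¹` and lives in the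
`ε`-neighborhood of `F`. -/
lemma norm_gradient_cutoff_le {E : Type*} [NormedAddCommGroup E] [InnerProductSpace ℝ E]
    [CompleteSpace E] (F : Set E) {ε : ℝ} (hε : 0 < ε) (x : E) :
    ‖gradient (fun w => min 1 (ε⁻¹ * infDist w F)) x‖ ≤
      (thickening ε F).indicator (fun _ => ε⁻¹) x := by
  rw [gradient, LinearIsometryEquiv.norm_map]
  by_cases hx : x ∈ thickening ε F
  · rw [indicator_of_mem hx]
    have hlip : LipschitzWith (ε⁻¹).toNNReal fun w => min 1 (ε⁻¹ * infDist w F) := by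
      refine LipschitzWith.const_min (LipschitzWith.of_dist_le_mul fun z w => ?_) 1
      have := (lipschitz_infDist_pt F).dist_le_mul z w
      rw [Real.dist_eq] at this ⊢
      rw [← mul_sub, abs_mul, abs_of_pos (inv_pos.2 hε), Real.coe_toNNReal _ (inv_pos.2 hε).le]
      gcongr
      simpa using this
    simpa [Real.coe_toNNReal _ (inv_pos.2 hε).le] using norm_fderiv_le_of_lipschitz ℝ hlip
  · rw [indicator_of_notMem hx]
    rcases F.eq_empty_or_nonempty with rfl | hF
    · simp
    · have h1 : ε ≤ infDist x F := by
        by_contra! h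
        exact hx ((mem_thickening_iff_infDist_lt hF).2 h)
      have h2 : (1 : ℝ) ≤ ε⁻¹ * infDist x F := by
        rw [← inv_mul_cancel₀ hε.ne']; gcongr
      have h3 : IsLocalMax (fun w => min 1 (ε⁻¹ * infDist w F)) x :=
        Eventually.of_forall fun w => by
          exact (min_le_left _ _).trans_eq (min_eq_left h2).symm
      rw [h3.fderiv_eq_zero, norm_zero]

lemma exists_volume_thickening_frontier_le {k : ℕ} {Ω : Set (EuclideanSpace ℝ (Fin (k + 1)))}
    (hΩ : IsOpen Ω) (hΩb : Bornology.IsBounded Ω)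
    (hch : ∀ x ∈ frontier Ω, ∃ c : BoundaryChart Ω, c.center = x ∧ 0 < c.radius) :
    ∃ ε₀ : ℝ, 0 < ε₀ ∧ ∀ ε : ℝ, 0 < ε → ε < ε₀ →
      volume (thickening ε (frontier Ω)) ≤ ENNReal.ofReal (2 * ε) * μH[(k : ℝ)] (frontier Ω) := by
  match k with
  | 0 => simpa only [Nat.cast_zero] using exists_volume_thickening_le_of_line hΩ hΩb hch
  | 1 => simpa only [Nat.cast_one] using exists_volume_thickening_le_of_plane hΩ hΩb hch
  | k + 2 => exact exists_volume_thickening_le_of_two_le (by omega) hΩ hΩb hch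

/-- for a bounded open set `Ω ⊆ ℝ^{k+1}` with Lipschitz boundary (every
boundary point has a neighborhood in which `Ω` is, after a rotation, the subgraph of a
Lipschitz function), there is `ε₀ > 0` such that for `ε < ε₀` the `ε`-neighborhood of
`∂Ω` has volume at most `2ε H^k(∂Ω)`; consequently for `χ_ε(x) = min{1, ε⁻¹ d(x,∂Ω)}`
and any bounded `Z`, `∫_Ω |Z·∇χ_ε| ≤ 2 ‖Z‖_∞ H^k(∂Ω)`. -/
theorem lipschitz_boundary_layer_estimate
    (k : ℕ) (Ω : Set (EuclideanSpace ℝ (Fin (k + 1))))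
    (hΩ : IsOpen Ω) (hΩb : Bornology.IsBounded Ω) (hΩne : Ω.Nonempty)
    (hlip : ∀ x ∈ frontier Ω, ∃ r : ℝ, 0 < r ∧
      ∃ A : EuclideanSpace ℝ (Fin (k + 1)) ≃ₗᵢ[ℝ] EuclideanSpace ℝ (Fin (k + 1)),
      ∃ f : (Fin k → ℝ) → ℝ, ∃ L : NNReal, LipschitzWith L f ∧
        ∀ z ∈ Metric.ball x r,
          (z ∈ Ω ↔ A z (Fin.last k) < f (fun i : Fin k => A z i.castSucc))) :
    ∃ ε₀ : ℝ, 0 < ε₀ ∧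
      (∀ ε : ℝ, 0 < ε → ε < ε₀ →
        volume (Metric.thickening ε (frontier Ω))
          ≤ ENNReal.ofReal (2 * ε) * μH[(k : ℝ)] (frontier Ω)) ∧
      (∀ Z : EuclideanSpace ℝ (Fin (k + 1)) → EuclideanSpace ℝ (Fin (k + 1)),
        ∀ C : ℝ, (∀ x, ‖Z x‖ ≤ C) →
        ∀ ε : ℝ, 0 < ε → ε < ε₀ →
          ∫ x in Ω,
            |⟪Z x, gradient (fun w : EuclideanSpace ℝ (Fin (k + 1)) =>
              min 1 (ε⁻¹ * Metric.infDist w (frontier Ω))) x⟫| ∂volume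
            ≤ 2 * C * (μH[(k : ℝ)] (frontier Ω)).toReal) := by
  have hch : ∀ x ∈ frontier Ω, ∃ c : BoundaryChart Ω, c.center = x ∧ 0 < c.radius := fun x hx => by
    obtain ⟨r, hr, A, f, L, hf, hmem⟩ := hlip x hx
    exact ⟨⟨x, r, A, f, L, hf, hmem⟩, rfl, hr⟩
  have hHfin := hausdorffMeasure_frontier_lt_top hΩ hΩb hch
  obtain ⟨ε₀, hε₀, hvol⟩ := exists_volume_thickening_frontier_le hΩ hΩb hch
  refine ⟨ε₀, hε₀, hvol, fun Z C hZ ε hε hεlt => ?_⟩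
  have hC : 0 ≤ C := (norm_nonneg _).trans (hZ 0)
  have hfin : ENNReal.ofReal (2 * ε) * μH[(k : ℝ)] (frontier Ω) ≠ ⊤ :=
    ENNReal.mul_ne_top ENNReal.ofReal_ne_top hHfin.ne
  have hthick := hvol ε hε hεlt
  have hthick_fin : volume (thickening ε (frontier Ω)) ≠ ⊤ := ne_top_of_le_ne_top hfin hthick
  have hint : Integrable ((thickening ε (frontier Ω)).indicator fun _ => C * ε⁻¹) volume :=
    (integrable_indicator_iff isOpen_thickening.measurableSet).2 (integrableOn_const hthick_fin)
  have hbound : ∀ x, ‖|⟪Z x, gradient (fun w : EuclideanSpace ℝ (Fin (k + 1)) =>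
      min 1 (ε⁻¹ * infDist w (frontier Ω))) x⟫|‖ ≤
        (thickening ε (frontier Ω)).indicator (fun _ => C * ε⁻¹) x := fun x => by
    rw [Real.norm_eq_abs, abs_abs, indicator_const_mul]
    exact (abs_real_inner_le_norm _ _).trans
      (mul_le_mul (hZ x) (norm_gradient_cutoff_le _ hε x) (norm_nonneg _) hC)
  have hreal : volume.real (thickening ε (frontier Ω)) ≤
      2 * ε * (μH[(k : ℝ)] (frontier Ω)).toReal := by
    refine (ENNReal.toReal_mono hfin hthick).trans_eq ?_
    rw [ENNReal.toReal_mul, ENNReal.toReal_ofReal (by positivity)]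
  calc ∫ x in Ω, |⟪Z x, gradient (fun w : EuclideanSpace ℝ (Fin (k + 1)) =>
        min 1 (ε⁻¹ * infDist w (frontier Ω))) x⟫| ∂volume
      ≤ ∫ x in Ω, (thickening ε (frontier Ω)).indicator (fun _ => C * ε⁻¹) x :=
        (Real.le_norm_self _).trans
          (norm_integral_le_of_norm_le hint.integrableOn (ae_of_all _ hbound))
    _ ≤ ∫ x, (thickening ε (frontier Ω)).indicator (fun _ => C * ε⁻¹) x :=
        setIntegral_le_integral hint (ae_of_all _ fun x => indicator_nonneg
          (fun _ _ => by positivity) x)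
    _ = volume.real (thickening ε (frontier Ω)) * (C * ε⁻¹) := by
        rw [integral_indicator_const _ isOpen_thickening.measurableSet, smul_eq_mul]
    _ ≤ 2 * ε * (μH[(k : ℝ)] (frontier Ω)).toReal * (C * ε⁻¹) := by gcongr
    _ = 2 * C * (μH[(k : ℝ)] (frontier Ω)).toReal := by field_simp
end
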